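/- arXiv:2206.09121 — 10 statements merged into one kernel-verified Lean document; each statement's English description precedes it below -/
import Mathlib

section
/- Let k be a field and S = k[x_1,...,x_n]. Let P_1,...,P_s be finitely many subspaces of the space of linear forms of S such that dim P_i ≤ r for all i and P_1 ∩ ... ∩ P_s = 0. Let I = (P_1) ∩ ... ∩ (P_s) be the intersection of the ideals generated by these subspaces. Then the dimension of the degree-2 homogeneous component I_2 of I satisfies dim I_2 ≤ r^2. -/
open MvPolynomial

namespace Submodule

variable {k A : Type*} [Field k] [CommRing A] [Algebra k A]

theorem finiteDimensional_mul (M N : Submodule k A) [FiniteDimensional k M]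
    [FiniteDimensional k N] : FiniteDimensional k ↥(M * N) :=
  .of_fg (.mul (Module.Finite.iff_fg.1 ‹_›) (Module.Finite.iff_fg.1 ‹_›))

theorem finrank_mul_le (M N : Submodule k A) [FiniteDimensional k M] [FiniteDimensional k N] :
    Module.finrank k ↥(M * N) ≤ Module.finrank k M * Module.finrank k N := by
  rw [← mulMap_range, ← Module.finrank_tensorProduct]
  exact LinearMap.finrank_range_le _

theorem finrank_le_add_of_le_sup {M N L : Submodule k A} [FiniteDimensional k M]
    [FiniteDimensional k N] [FiniteDimensional k L] (h : M ≤ N ⊔ L) :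
    Module.finrank k M ≤ Module.finrank k ↥(M ⊓ N) + Module.finrank k L := by
  have h1 := finrank_sup_add_finrank_inf_eq M N
  have h2 := finrank_mono (sup_le h (le_sup_left : N ≤ N ⊔ L))
  have h3 := finrank_add_le_finrank_add_finrank N L
  lia

end Submodule

namespace MvPolynomial

variable {k σ : Type*} [Field k]

theorem mul_linear_inf_le {P Q C : Submodule k (MvPolynomial σ k)}
    (hP : P ≤ homogeneousSubmodule σ k 1) (hQ : Q ≤ homogeneousSubmodule σ k 1)
    (hC : (Q ⊓ P) ⊔ C = Q) (hCP : Disjoint C P) :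
    Q * homogeneousSubmodule σ k 1 ⊓ P * homogeneousSubmodule σ k 1 ≤
      (Q ⊓ P) * homogeneousSubmodule σ k 1 ⊔ C * P := by
  obtain ⟨D, hCD, hD⟩ := hCP.exists_isCompl
  let φ := D.projection P hD
  let Φ : MvPolynomial σ k →ₐ[k] MvPolynomial σ k := aeval fun i ↦ φ (X i)
  have hΦ : ∀ v ∈ homogeneousSubmodule σ k 1, Φ v = φ v := by
    rw [homogeneousSubmodule_one_eq_span_X]
    refine LinearMap.eqOn_span (f := Φ.toLinearMap) ?_
    rintro _ ⟨i, rfl⟩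
    simp [Φ]
  have hΦP : P * homogeneousSubmodule σ k 1 ≤ LinearMap.ker Φ.toLinearMap := by
    refine Submodule.mul_le.2 fun p hp v _ ↦ ?_
    have : φ p = 0 := (Submodule.projection_apply_eq_zero_iff hD).2 hp
    simp [hΦ p (hP hp), this]
  have hΦC : ∀ g ∈ C * homogeneousSubmodule σ k 1, g - Φ g ∈ C * P := by
    intro g hg
    induction hg using Submodule.mul_induction_on' with
    | mem_mul_mem c hc v hv =>
      have hcQ : c ∈ Q := hC ▸ Submodule.mem_sup_right hc
      have : φ c = c := Submodule.projection_apply_of_mem_left hD (hCD hc)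
      rw [map_mul, hΦ c (hQ hcQ), hΦ v hv, this, ← mul_sub]
      exact Submodule.mul_mem_mul hc (Submodule.sub_projection_mem hD v)
    | add x _ y _ hx hy =>
      rw [map_add, add_sub_add_comm]
      exact add_mem hx hy
  rintro f ⟨hfQ, hfP⟩
  rw [SetLike.mem_coe, ← hC, Submodule.sup_mul] at hfQ
  obtain ⟨a, ha, g, hg, rfl⟩ := Submodule.mem_sup.1 hfQ
  have ha0 : Φ a = 0 := hΦP ((mul_le_mul' inf_le_right le_rfl :
    (Q ⊓ P) * homogeneousSubmodule σ k 1 ≤ P * homogeneousSubmodule σ k 1) ha)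
  have hag : Φ (a + g) = 0 := hΦP hfP
  rw [map_add, ha0, zero_add] at hag
  have := hΦC g hg
  rw [hag, sub_zero] at this
  exact Submodule.add_mem_sup ha this

theorem homogeneousComponent_add_mul (a : MvPolynomial σ k) {p : MvPolynomial σ k} {m : ℕ}
    (hp : p.IsHomogeneous m) (d : ℕ) :
    homogeneousComponent (d + m) (a * p) = homogeneousComponent d a * p := by
  let _ : GradedAlgebra (homogeneousSubmodule σ k) := gradedAlgebra
  have := DirectSum.coe_decompose_mul_of_right_mem_of_le (homogeneousSubmodule σ k)
    (a := a) (n := d + m) hp (Nat.le_add_left m d)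
  simp only [← decomposition.decompose'_apply]
  rwa [Nat.add_sub_cancel] at this

theorem span_inf_homogeneousSubmodule_two_le {P : Submodule k (MvPolynomial σ k)}
    (hP : P ≤ homogeneousSubmodule σ k 1) :
    (Ideal.span (P : Set (MvPolynomial σ k))).restrictScalars k ⊓ homogeneousSubmodule σ k 2 ≤
      P * homogeneousSubmodule σ k 1 := by
  have key : ∀ f ∈ Ideal.span (P : Set (MvPolynomial σ k)), ∀ a,
      homogeneousComponent 2 (a * f) ∈ P * homogeneousSubmodule σ k 1 := by
    intro f hf
    induction hf using Submodule.span_induction with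
    | mem p hp =>
      intro a
      rw [homogeneousComponent_add_mul a (hP hp) 1, mul_comm _ p]
      exact Submodule.mul_mem_mul hp (homogeneousComponent_isHomogeneous 1 a)
    | zero => simp
    | add x y _ _ hx hy =>
      intro a
      rw [mul_add, map_add]
      exact add_mem (hx a) (hy a)
    | smul b x _ hx =>
      intro a
      rw [smul_eq_mul, ← mul_assoc]
      exact hx (a * b)
  rintro f ⟨hf, hf2⟩
  simpa [homogeneousComponent_eq_self hf2] using key f hf 1

theorem finrank_mul_linear_inf_le [Finite σ] {ι : Type*} {r : ℕ}
    {P : ι → Submodule k (MvPolynomial σ k)}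
    (hlin : ∀ i, P i ≤ homogeneousSubmodule σ k 1) (hdim : ∀ i, Module.finrank k (P i) ≤ r)
    (t : Finset ι) {Q : Submodule k (MvPolynomial σ k)} (hQ : Q ≤ homogeneousSubmodule σ k 1)
    (hint : Q ⊓ ⨅ i ∈ t, P i = ⊥) :
    Module.finrank k
      ↥(Q * homogeneousSubmodule σ k 1 ⊓ ⨅ i ∈ t, P i * homogeneousSubmodule σ k 1) ≤
        Module.finrank k Q * r := by
  classical
  have : FiniteDimensional k (homogeneousSubmodule σ k 1) :=
    .of_fg (homogeneousSubmodule_fg σ k 1)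
  have hfin : ∀ {M : Submodule k (MvPolynomial σ k)}, M ≤ homogeneousSubmodule σ k 1 →
      FiniteDimensional k M := Submodule.finiteDimensional_of_le
  induction t using Finset.induction_on generalizing Q with
  | empty =>
    obtain rfl : Q = ⊥ := by simpa using hint
    rw [Submodule.bot_mul, bot_inf_eq, finrank_bot]
    exact Nat.zero_le _
  | insert j t _ ih =>
    rw [Finset.iInf_insert] at hint ⊢
    obtain ⟨C, hdisj, hsup⟩ := IsModularLattice.exists_disjoint_and_sup_eq (inf_le_left : Q ⊓ P j ≤ Q)
    have hCQ : C ≤ Q := hsup ▸ le_sup_right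
    have hCP : Disjoint C (P j) := by
      rw [disjoint_iff, ← inf_eq_right.2 hCQ, inf_right_comm]
      exact hdisj.eq_bot
    have hQP : Q ⊓ P j ≤ homogeneousSubmodule σ k 1 := inf_le_left.trans hQ
    have hQfin := hfin hQ
    have hPfin := hfin (hlin j)
    have hCfin := hfin (hCQ.trans hQ)
    have hQPfin := hfin hQP
    set R := ⨅ i ∈ t, P i * homogeneousSubmodule σ k 1
    have hle : Q * homogeneousSubmodule σ k 1 ⊓ (P j * homogeneousSubmodule σ k 1 ⊓ R) ≤
        (Q ⊓ P j) * homogeneousSubmodule σ k 1 ⊔ C * P j :=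
      (inf_assoc (a := Q * homogeneousSubmodule σ k 1) _ R).ge.trans
        (inf_le_left.trans (mul_linear_inf_le (hlin j) hQ hsup hCP))
    have := C.finiteDimensional_mul (P j)
    have := Q.finiteDimensional_mul (homogeneousSubmodule σ k 1)
    have := (Q ⊓ P j).finiteDimensional_mul (homogeneousSubmodule σ k 1)
    have hM : FiniteDimensional k
        ↥(Q * homogeneousSubmodule σ k 1 ⊓ (P j * homogeneousSubmodule σ k 1 ⊓ R)) :=
      Submodule.finiteDimensional_of_le inf_le_left
    have hN : FiniteDimensional k ↥((Q ⊓ P j) * homogeneousSubmodule σ k 1 ⊓ R) :=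
      Submodule.finiteDimensional_of_le inf_le_left
    have hdimQ : Module.finrank k Q = Module.finrank k ↥(Q ⊓ P j) + Module.finrank k C := by
      have := Submodule.finrank_sup_add_finrank_inf_eq (Q ⊓ P j) C
      rw [hsup, hdisj.eq_bot, finrank_bot] at this
      exact this
    calc
      _ ≤ _ + Module.finrank k ↥(C * P j) := Submodule.finrank_le_add_of_le_sup hle
      _ ≤ Module.finrank k ↥((Q ⊓ P j) * homogeneousSubmodule σ k 1 ⊓ R) +
          Module.finrank k C * Module.finrank k (P j) :=
        add_le_add (Submodule.finrank_mono
          (le_inf inf_le_right (inf_le_left.trans (inf_le_right.trans inf_le_right))))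
          (Submodule.finrank_mul_le _ _)
      _ ≤ Module.finrank k ↥(Q ⊓ P j) * r + Module.finrank k C * r :=
        add_le_add (ih hQP (inf_assoc Q (P j) _ ▸ hint)) (Nat.mul_le_mul_left _ (hdim j))
      _ = Module.finrank k Q * r := by rw [hdimQ, add_mul]

end MvPolynomial

/-- If `P_1, …, P_s` are subspaces of linear forms in `k[x_1,…,x_n]`
with `dim P_i ≤ r` and trivial common intersection, then the degree-2 component of the
ideal `I = (P_1) ∩ ⋯ ∩ (P_s)` has dimension at most `r²`. -/
theorem quadratic_dim_le_of_trivial_intersection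
    {k : Type*} [Field k] {n : ℕ} (r s : ℕ)
    (P : Fin s → Submodule k (MvPolynomial (Fin n) k))
    (hlin : ∀ i, P i ≤ homogeneousSubmodule (Fin n) k 1)
    (hdim : ∀ i, Module.finrank k (P i) ≤ r)
    (hint : (⨅ i, P i) = ⊥) :
    Module.finrank k
      ↥(Submodule.restrictScalars k
          (⨅ i, Ideal.span ((P i : Set (MvPolynomial (Fin n) k)))) ⊓
        homogeneousSubmodule (Fin n) k 2) ≤ r ^ 2 := by
  obtain _ | s := s
  · rw [iInf_of_empty] at hint
    exact absurd hint top_ne_bot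
  have : FiniteDimensional k (homogeneousSubmodule (Fin n) k 1) :=
    .of_fg (homogeneousSubmodule_fg (Fin n) k 1)
  have : FiniteDimensional k (P 0) := Submodule.finiteDimensional_of_le (hlin 0)
  have : FiniteDimensional k ↥(P 0 * homogeneousSubmodule (Fin n) k 1) :=
    (P 0).finiteDimensional_mul _
  have hbound := finrank_mul_linear_inf_le hlin hdim Finset.univ (hlin 0)
    (eq_bot_iff.2 (inf_le_right.trans (by simpa using hint.le)))
  have : FiniteDimensional k ↥(P 0 * homogeneousSubmodule (Fin n) k 1 ⊓
      ⨅ i ∈ Finset.univ, P i * homogeneousSubmodule (Fin n) k 1) :=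
    Submodule.finiteDimensional_of_le inf_le_left
  have hle : ∀ i, Submodule.restrictScalars k
        (⨅ i, Ideal.span ((P i : Set (MvPolynomial (Fin n) k)))) ⊓
      homogeneousSubmodule (Fin n) k 2 ≤ P i * homogeneousSubmodule (Fin n) k 1 := by
    intro i f hf
    exact span_inf_homogeneousSubmodule_two_le (hlin i)
      ⟨(Submodule.mem_iInf _).1 hf.1 i, hf.2⟩
  refine (Submodule.finrank_mono (le_inf (hle 0) (le_iInf₂ fun i _ ↦ hle i))).trans
    (hbound.trans ?_)
  rw [sq]
  exact Nat.mul_le_mul_right r (hdim 0)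
end

section
/- Let k be a field and S = k[x_1,...,x_n]. Let (P_s)_{s∈S'} be any (possibly infinite) collection of subspaces of the space of linear forms of S with dim P_s ≤ r for all s, and let I = ∩_{s∈S'} (P_s) be the intersection of the ideals they generate. Then I has at most r^2 generators of degree 2, i.e., dim( I_2 / (S_1 · I_1) ) ≤ r^2, where S_1 is the space of linear forms. -/
open MvPolynomial

/-- An algebra endomorphism extending a linear map on the linear forms. -/
theorem aeval_X_eq_of_mem_homogeneousSubmodule_one {k σ : Type*} [Field k]
    (T : MvPolynomial σ k →ₗ[k] MvPolynomial σ k) {p : MvPolynomial σ k}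
    (hp : p ∈ homogeneousSubmodule σ k 1) :
    aeval (fun i => T (X i)) p = T p := by
  rw [homogeneousSubmodule_one_eq_span_X] at hp
  induction hp using Submodule.span_induction with
  | mem x hx => obtain ⟨i, rfl⟩ := hx; simp
  | zero => simp
  | add x y _ _ hx hy => rw [map_add, map_add, hx, hy]
  | smul c x _ hx => rw [map_smul, map_smul, hx]

theorem mem_of_mem_span_of_mem_homogeneousSubmodule_one {k σ : Type*} [Field k]
    {P : Submodule k (MvPolynomial σ k)} (hP : P ≤ homogeneousSubmodule σ k 1)
    {f : MvPolynomial σ k} (hf : f ∈ homogeneousSubmodule σ k 1)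
    (hfP : f ∈ Ideal.span (P : Set (MvPolynomial σ k))) : f ∈ P := by
  obtain ⟨C, hC⟩ := exists_isCompl P
  set T := C.projection P hC.symm
  have hker : Ideal.span (P : Set (MvPolynomial σ k)) ≤
      RingHom.ker (aeval (R := k) fun i => T (X i)) := by
    refine Ideal.span_le.2 fun p hp => ?_
    rw [SetLike.mem_coe, RingHom.mem_ker, aeval_X_eq_of_mem_homogeneousSubmodule_one T (hP hp)]
    exact (Submodule.projection_apply_eq_zero_iff hC.symm).2 hp
  have h := hker hfP
  rw [RingHom.mem_ker, aeval_X_eq_of_mem_homogeneousSubmodule_one T hf] at h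
  exact (Submodule.projection_apply_eq_zero_iff hC.symm).1 h

/-- For spaces of linear forms `Q₁ ≤ P` and `Q₀` disjoint from `P`, the quadrics generated by
`Q₁ ⊔ Q₀` which lie in the ideal of `P` are generated by `Q₁` and `Q₀ * P`. -/
theorem mem_mul_sup_of_mem_span {k σ : Type*} [Field k]
    {P Q₀ Q₁ : Submodule k (MvPolynomial σ k)} (hP : P ≤ homogeneousSubmodule σ k 1)
    (hQ₀ : Q₀ ≤ homogeneousSubmodule σ k 1) (hdisj : Disjoint P Q₀) (hQ₁ : Q₁ ≤ P)
    {f : MvPolynomial σ k} (hf : f ∈ homogeneousSubmodule σ k 1 * (Q₁ ⊔ Q₀))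
    (hfP : f ∈ Ideal.span (P : Set (MvPolynomial σ k))) :
    f ∈ homogeneousSubmodule σ k 1 * Q₁ ⊔ Q₀ * P := by
  obtain ⟨C, hQ₀C, hC⟩ := hdisj.symm.exists_isCompl
  set T := C.projection P hC
  set φ := aeval (R := k) fun i => T (X i)
  have hφ {p} (hp : p ∈ homogeneousSubmodule σ k 1) : φ p = T p :=
    aeval_X_eq_of_mem_homogeneousSubmodule_one T hp
  have hφP {p} (hp : p ∈ P) : φ p = 0 :=
    (hφ (hP hp)).trans ((Submodule.projection_apply_eq_zero_iff hC).2 hp)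
  have hker : Ideal.span (P : Set (MvPolynomial σ k)) ≤ RingHom.ker φ :=
    Ideal.span_le.2 fun p hp => hφP hp
  rw [Submodule.mul_sup] at hf
  obtain ⟨h, hh, g, hg, rfl⟩ := Submodule.mem_sup.1 hf
  have hφh : φ h = 0 := by
    clear hf hfP
    induction hh using Submodule.mul_induction_on' with
    | mem_mul_mem a _ b hb => rw [map_mul, hφP (hQ₁ hb), mul_zero]
    | add x _ y _ hx hy => rw [map_add, hx, hy, add_zero]
  have hsub : g - φ g ∈ Q₀ * P := by
    clear hf hfP
    induction hg using Submodule.mul_induction_on' with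
    | mem_mul_mem b hb a ha =>
      have hTa : T a = a := Submodule.projection_apply_of_mem_left hC (hQ₀C ha)
      rw [map_mul, hφ hb, hφ (hQ₀ ha), hTa, ← sub_mul, mul_comm (b - T b)]
      exact Submodule.mul_mem_mul ha (Submodule.sub_projection_mem hC b)
    | add x _ y _ hx hy =>
      rw [map_add, add_sub_add_comm]
      exact add_mem hx hy
  have hφg : φ g = 0 := by
    have := hker hfP
    rwa [RingHom.mem_ker, map_add, hφh, zero_add] at this
  rw [hφg, sub_zero] at hsub
  exact Submodule.add_mem_sup hh hsub

theorem Submodule.finrank_mul_le_s1 {k A : Type*} [Field k] [CommRing A] [Algebra k A]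
    (P Q : Submodule k A) [Module.Finite k P] [Module.Finite k Q] :
    Module.finrank k ↥(P * Q) ≤ Module.finrank k P * Module.finrank k Q := by
  rw [← Module.finrank_tensorProduct, ← Submodule.mulMap_range]
  exact LinearMap.finrank_range_le _

theorem Submodule.finrank_le_finrank_inf_add {k V : Type*} [Field k] [AddCommGroup V] [Module k V]
    {N D E : Submodule k V} [Module.Finite k N] [Module.Finite k D] [Module.Finite k E]
    (h : N ≤ D ⊔ E) :
    Module.finrank k N ≤ Module.finrank k ↥(N ⊓ D) + Module.finrank k E := by
  have h₁ := Submodule.finrank_sup_add_finrank_inf_eq N D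
  have h₂ := Submodule.finrank_mono (sup_le h le_sup_left)
  have h₃ := Submodule.finrank_add_le_finrank_add_finrank D E
  omega

/-- Bounding the quadrics in `⨅ i, (P i)` that are generated by a space `Q` of linear forms, by
intersecting `Q` successively with the `P i`. -/
theorem finrank_quadrics_inf_mul_add_le {k σ ι : Type*} [Field k] [Finite σ] {r : ℕ}
    {P : ι → Submodule k (MvPolynomial σ k)}
    (hlin : ∀ i, P i ≤ homogeneousSubmodule σ k 1)
    (hdim : ∀ i, Module.finrank k (P i) ≤ r)
    {J L : Submodule k (MvPolynomial σ k)}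
    (hJ : ∀ i, ∀ f ∈ J, f ∈ Ideal.span (P i : Set (MvPolynomial σ k)))
    (hL : ∀ f, f ∈ L ↔ f ∈ homogeneousSubmodule σ k 1 ∧ ∀ i, f ∈ P i)
    (Q : Submodule k (MvPolynomial σ k)) (hQ : Q ≤ homogeneousSubmodule σ k 1) (hLQ : L ≤ Q) :
    Module.finrank k ↥(J ⊓ homogeneousSubmodule σ k 1 * Q) + r * Module.finrank k L ≤
      r * Module.finrank k Q + Module.finrank k ↥(homogeneousSubmodule σ k 1 * L) := by
  have hfin : Module.Finite k (homogeneousSubmodule σ k 1) :=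
    Module.Finite.iff_fg.2 (homogeneousSubmodule_fg σ k 1)
  have finite_of_le {M : Submodule k (MvPolynomial σ k)}
      (hM : M ≤ homogeneousSubmodule σ k 1) : Module.Finite k M :=
    Submodule.finiteDimensional_of_le hM
  have finite_mul {M N : Submodule k (MvPolynomial σ k)}
      (hM : M ≤ homogeneousSubmodule σ k 1) (hN : N ≤ homogeneousSubmodule σ k 1) :
      Module.Finite k ↥(M * N) :=
    Module.Finite.iff_fg.2 ((Module.Finite.iff_fg.1 (finite_of_le hM)).mul
      (Module.Finite.iff_fg.1 (finite_of_le hN)))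
  induction hd : Module.finrank k Q using Nat.strong_induction_on generalizing Q with
  | _ d ih =>
  have := finite_of_le hQ
  have := finite_mul le_rfl hQ
  by_cases hall : ∀ i, Q ≤ P i
  · obtain rfl : L = Q := le_antisymm hLQ fun f hf => (hL f).2 ⟨hQ hf, fun i => hall i hf⟩
    have := Submodule.finrank_mono
      (inf_le_right : J ⊓ homogeneousSubmodule σ k 1 * L ≤ homogeneousSubmodule σ k 1 * L)
    rw [hd]
    omega
  obtain ⟨i, hi⟩ := not_forall.1 hall
  have hlt : Q ⊓ P i < Q := inf_lt_left.2 hi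
  have hQ' : Q ⊓ P i ≤ homogeneousSubmodule σ k 1 := hlt.le.trans hQ
  have := finite_mul le_rfl hQ'
  have hstep := ih _ (hd ▸ Submodule.finrank_lt_finrank_of_lt hlt) _ hQ'
    (le_inf hLQ fun f hf => ((hL f).1 hf).2 i) rfl
  obtain ⟨Q₀, hdisj, hsup⟩ : ∃ Q₀, Disjoint (Q ⊓ P i) Q₀ ∧ (Q ⊓ P i) ⊔ Q₀ = Q := by
    obtain ⟨C, hC⟩ := exists_isCompl (Q ⊓ P i)
    refine ⟨C ⊓ Q, hC.disjoint.mono_right inf_le_left, ?_⟩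
    rw [← sup_inf_assoc_of_le C inf_le_left, hC.sup_eq_top, top_inf_eq]
  have hQ₀Q : Q₀ ≤ Q := hsup ▸ le_sup_right
  have hQ₀ := hQ₀Q.trans hQ
  have hdisjP : Disjoint (P i) Q₀ := by
    rw [disjoint_iff, ← inf_eq_right.2 hQ₀Q, ← inf_assoc, inf_comm (P i)]
    exact hdisj.eq_bot
  have := finite_of_le hQ₀
  have := finite_of_le hQ'
  have := finite_of_le (hlin i)
  have := finite_mul hQ₀ (hlin i)
  have hcover : J ⊓ homogeneousSubmodule σ k 1 * Q ≤
      homogeneousSubmodule σ k 1 * (Q ⊓ P i) ⊔ Q₀ * P i := fun f hf =>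
    mem_mul_sup_of_mem_span (hlin i) hQ₀ hdisjP inf_le_right (hsup.symm ▸ hf.2) (hJ i f hf.1)
  have hfinJ : Module.Finite k ↥(J ⊓ homogeneousSubmodule σ k 1 * Q) :=
    Submodule.finiteDimensional_of_le inf_le_right
  have hle := Submodule.finrank_le_finrank_inf_add hcover
  rw [inf_assoc, inf_eq_right.2 (mul_le_mul' le_rfl hlt.le)] at hle
  have hmul : Module.finrank k ↥(Q₀ * P i) ≤ r * Module.finrank k Q₀ :=
    (Submodule.finrank_mul_le_s1 _ _).trans
      ((Nat.mul_le_mul_left _ (hdim i)).trans (mul_comm _ _).le)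
  have hadd : Module.finrank k ↥(Q ⊓ P i) + Module.finrank k Q₀ = d := by
    rw [← hd, ← Submodule.finrank_sup_add_finrank_inf_eq, hsup, hdisj.eq_bot, finrank_bot,
      add_zero]
  rw [← hadd, mul_add]
  omega

/-- **Theorem B.** For any (possibly infinite) collection `(P_i)` of subspaces
of linear forms of `k[x_1,…,x_n]` with `dim P_i ≤ r`, the intersection `I = ∩ (P_i)` of the
ideals they generate has at most `r²` generators of degree 2, i.e.
`dim (I_2 / (S_1 · I_1)) ≤ r²`. -/
theorem quadratic_generators_le_sq
    {k : Type*} [Field k] {n : ℕ} (r : ℕ) {ι : Type*}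
    (P : ι → Submodule k (MvPolynomial (Fin n) k))
    (hlin : ∀ i, P i ≤ homogeneousSubmodule (Fin n) k 1)
    (hdim : ∀ i, Module.finrank k (P i) ≤ r)
    (I : Ideal (MvPolynomial (Fin n) k))
    (hI : I = ⨅ i, Ideal.span ((P i : Set (MvPolynomial (Fin n) k))))
    (I₂ I₁ S₁I₁ : Submodule k (MvPolynomial (Fin n) k))
    (hI₂ : I₂ = Submodule.restrictScalars k I ⊓ homogeneousSubmodule (Fin n) k 2)
    (hI₁ : I₁ = Submodule.restrictScalars k I ⊓ homogeneousSubmodule (Fin n) k 1)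
    (hS₁I₁ : S₁I₁ = Submodule.span k
      {q : MvPolynomial (Fin n) k |
        ∃ p ∈ homogeneousSubmodule (Fin n) k 1, ∃ g ∈ I₁, q = p * g}) :
    Module.finrank k (↥I₂ ⧸ Submodule.comap I₂.subtype S₁I₁) ≤ r ^ 2 := by
  have hsq : homogeneousSubmodule (Fin n) k 1 * homogeneousSubmodule (Fin n) k 1 =
      homogeneousSubmodule (Fin n) k 2 := by
    rw [← pow_two, homogeneousSubmodule_one_pow]
  have hL (f) : f ∈ I₁ ↔ f ∈ homogeneousSubmodule (Fin n) k 1 ∧ ∀ i, f ∈ P i := by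
    rw [hI₁, Submodule.mem_inf, Submodule.restrictScalars_mem, hI, Submodule.mem_iInf, and_comm]
    exact and_congr_right fun hf => forall_congr' fun i =>
      ⟨mem_of_mem_span_of_mem_homogeneousSubmodule_one (hlin i) hf,
        fun h => Ideal.subset_span h⟩
  have hJ (i) (f) (hf : f ∈ I₂) :
      f ∈ Ideal.span (P i : Set (MvPolynomial (Fin n) k)) := by
    rw [hI₂, Submodule.mem_inf, Submodule.restrictScalars_mem, hI, Submodule.mem_iInf] at hf
    exact hf.1 i
  have hI₂le : I₂ ≤ homogeneousSubmodule (Fin n) k 2 := hI₂ ▸ inf_le_right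
  have hK : S₁I₁ = homogeneousSubmodule (Fin n) k 1 * I₁ := by
    rw [hS₁I₁, Submodule.mul_eq_span_mul_set]
    congr 1
    ext q
    simp only [Set.mem_mul, Set.mem_ofPred_eq, SetLike.mem_coe, eq_comm]
  have hKle : S₁I₁ ≤ I₂ := by
    rw [hK, hI₂]
    refine le_inf (Submodule.mul_le.2 fun p _ g hg => ?_) ?_
    · rw [hI₁] at hg
      exact I.mul_mem_left p hg.1
    · rw [← hsq]
      exact mul_le_mul' le_rfl (hI₁ ▸ inf_le_right)
  have hfin₂ : Module.Finite k (homogeneousSubmodule (Fin n) k 2) :=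
    Module.Finite.iff_fg.2 (homogeneousSubmodule_fg _ _ _)
  have hfinI₂ : Module.Finite k I₂ := Submodule.finiteDimensional_of_le hI₂le
  have hquot := Submodule.finrank_quotient_add_finrank (Submodule.comap I₂.subtype S₁I₁)
  rw [(Submodule.comapSubtypeEquivOfLe hKle).finrank_eq] at hquot
  obtain ⟨Q, hQ, hLQ, hI₂Q, hrQ⟩ : ∃ Q ≤ homogeneousSubmodule (Fin n) k 1, I₁ ≤ Q ∧
      I₂ ≤ homogeneousSubmodule (Fin n) k 1 * Q ∧
      r * Module.finrank k Q ≤ r ^ 2 + r * Module.finrank k I₁ := by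
    rcases isEmpty_or_nonempty ι with hι | ⟨⟨i⟩⟩
    · have : I₁ = homogeneousSubmodule (Fin n) k 1 := by
        ext f
        simp [hL f]
      exact ⟨I₁, this.le, le_rfl, by rwa [this, hsq], Nat.le_add_left _ _⟩
    · refine ⟨P i, hlin i, fun f hf => ((hL f).1 hf).2 i, fun f hf => ?_, ?_⟩
      · obtain ⟨C, hC⟩ := exists_isCompl (P i)
        have hsup : P i ⊔ C ⊓ homogeneousSubmodule (Fin n) k 1 =
            homogeneousSubmodule (Fin n) k 1 := by
          rw [← sup_inf_assoc_of_le C (hlin i), hC.sup_eq_top, top_inf_eq]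
        have hf' := mem_mul_sup_of_mem_span (hlin i) inf_le_right
          (hC.disjoint.mono_right inf_le_left) le_rfl
          (by rw [hsup, hsq]; exact hI₂le hf) (hJ i f hf)
        exact (sup_le le_rfl (mul_le_mul_left inf_le_right (P i)) :
          _ ≤ homogeneousSubmodule (Fin n) k 1 * P i) hf'
      · rw [pow_two]
        exact (Nat.mul_le_mul_left r (hdim i)).trans (Nat.le_add_right _ _)
  have hmain := finrank_quadrics_inf_mul_add_le hlin hdim hJ hL Q hQ hLQ
  rw [inf_eq_left.2 hI₂Q, ← hK] at hmain
  omega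
end

section
/- Let k be a field and S = k[x_1,...,x_n]. Let P_1, P_2, P_3 be subspaces of the space of linear forms with dim P_i = r for i = 1,2,3 and P_i ∩ P_j = 0 for all i ≠ j. Let I = (P_1) ∩ (P_2) ∩ (P_3) and let k₀ = dim( P_3 ∩ (P_1 + P_2) ). Then the degree-2 homogeneous component of I has dimension dim I_2 = k₀(k₀−1)/2 (i.e., the binomial coefficient C(k₀, 2)). -/
open MvPolynomial

/-- A linearly independent family can be enlarged to a basis that restricts to it. -/
theorem LinearIndependent.exists_basis_sum {K V ι : Type*} [DivisionRing K] [AddCommGroup V]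
    [Module K V] {v : ι → V} (hv : LinearIndependent K v) :
    ∃ (s : Set V) (b : Module.Basis (ι ⊕ s) K V), ∀ i, b (Sum.inl i) = v i := by
  classical
  refine ⟨_, Module.Basis.sumExtend hv, fun i => ?_⟩
  simp only [Module.Basis.sumExtend, Module.Basis.reindex_apply, Module.Basis.extend_apply_self]
  exact congrArg Subtype.val (Equiv.Set.sumDiffSubset_apply_inl
    (hv.linearIndepOn_id.subset_extend (Set.subset_univ (Set.range v)))
    (Equiv.ofInjective v hv.injective i))

/-- A linear map on `p` extends to the whole space by zero on a subspace disjoint from `p`. -/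
theorem LinearMap.exists_extend_of_disjoint {K V W : Type*} [DivisionRing K] [AddCommGroup V]
    [Module K V] [AddCommGroup W] [Module K W] {p q : Submodule K V} (h : Disjoint p q)
    (f : p →ₗ[K] W) :
    ∃ g : V →ₗ[K] W, (∀ x : p, g x = f x) ∧ ∀ x ∈ q, g x = 0 := by
  obtain ⟨c, hqc, hc⟩ := h.symm.exists_isCompl
  refine ⟨f ∘ₗ p.projectionOnto c hc.symm, fun x => ?_, fun x hx => ?_⟩
  · simp
  · simp [Submodule.projectionOnto_apply_of_mem_right _ (hqc hx)]

namespace MvPolynomial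

section

variable {k σ : Type*} [Field k]

/-- The algebra map that sends each variable to its image under `f` agrees with `f` on linear
forms. -/
theorem aeval_linearMap_of_mem_one {R : Type*} [CommSemiring R] [Algebra k R]
    (f : MvPolynomial σ k →ₗ[k] R) {p : MvPolynomial σ k}
    (hp : p ∈ homogeneousSubmodule σ k 1) :
    aeval (fun i => f (X i)) p = f p := by
  rw [homogeneousSubmodule_one_eq_span_X] at hp
  have : Set.EqOn (aeval (R := k) (fun i => f (X i))).toLinearMap f (Set.range X) := by
    rintro _ ⟨i, rfl⟩
    simp
  exact LinearMap.eqOn_span this hp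

/-- A quadratic form in the ideal generated by a space `P` of linear forms is a sum of products
of an element of `P` and a linear form. -/
theorem mem_mul_of_mem_span_of_isHomogeneous_two {P : Submodule k (MvPolynomial σ k)}
    (hP : P ≤ homogeneousSubmodule σ k 1) {q : MvPolynomial σ k}
    (hq : q ∈ Ideal.span (P : Set (MvPolynomial σ k))) (hq2 : q ∈ homogeneousSubmodule σ k 2) :
    q ∈ P * homogeneousSubmodule σ k 1 := by
  have key : ∀ q ∈ Ideal.span (P : Set (MvPolynomial σ k)),
      homogeneousComponent 2 q ∈ P * homogeneousSubmodule σ k 1 := by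
    intro q hq
    induction hq using Submodule.closure_induction with
    | zero => simp
    | add x y _ _ hx hy => rw [map_add]; exact add_mem hx hy
    | smul_mem r x hx =>
      let := gradedAlgebra (σ := σ) (R := k)
      have := DirectSum.coe_decompose_mul_add_of_left_mem
        (homogeneousSubmodule σ k) (i := 1) (j := 1) (b := r) (hP hx)
      rw [smul_eq_mul, mul_comm r x]
      rw [← decomposition.decompose'_apply]
      change (DirectSum.decompose (homogeneousSubmodule σ k) (x * r) (1 + 1) :
        MvPolynomial σ k) ∈ _
      rw [this]
      exact Submodule.mul_mem_mul hx (SetLike.coe_mem _)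
  rw [← homogeneousComponent_eq_self hq2]
  exact key q hq

/-- A quadratic form lying in the ideals generated by two disjoint spaces of linear forms is a sum
of products of elements of these spaces. -/
theorem mem_mul_of_mem_span_of_mem_span {P Q : Submodule k (MvPolynomial σ k)}
    (hP : P ≤ homogeneousSubmodule σ k 1) (hQ : Q ≤ homogeneousSubmodule σ k 1)
    (hPQ : Disjoint P Q) {q : MvPolynomial σ k}
    (hqP : q ∈ Ideal.span (P : Set (MvPolynomial σ k)))
    (hqQ : q ∈ Ideal.span (Q : Set (MvPolynomial σ k)))
    (hq2 : q ∈ homogeneousSubmodule σ k 2) :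
    q ∈ P * Q := by
  obtain ⟨c, hQc, hc⟩ := hPQ.symm.exists_isCompl
  set π := c.projection P hc with hπ
  have hfix : ∀ y ∈ c, π y = y := fun y hy => by
    rw [hπ, Submodule.projection_apply, Submodule.projectionOnto_apply_of_mem_left hc hy]
  have hsub : ∀ v, v - π v ∈ P := fun v => by
    rw [← Submodule.projection_apply_eq_zero_iff hc, map_sub, ← hπ,
      hfix _ (Submodule.projection_apply_mem hc v), sub_self]
  set θ : MvPolynomial σ k →ₐ[k] MvPolynomial σ k := aeval fun i => π (X i) with hθ
  have hker : Ideal.span (P : Set (MvPolynomial σ k)) ≤ RingHom.ker θ := by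
    rw [Ideal.span_le]
    intro p hp
    rw [SetLike.mem_coe, RingHom.mem_ker, hθ, aeval_linearMap_of_mem_one _ (hP hp), hπ,
      Submodule.projection_apply_eq_zero_iff]
    exact hp
  have key : ∀ q ∈ Q * homogeneousSubmodule σ k 1, q - θ q ∈ Q * P := by
    intro q hq
    induction hq using Submodule.mul_induction_on' with
    | mem_mul_mem y hy v hv =>
      rw [map_mul, hθ, aeval_linearMap_of_mem_one _ (hQ hy), aeval_linearMap_of_mem_one _ hv,
        hfix y (hQc hy), ← mul_sub]
      exact Submodule.mul_mem_mul hy (hsub v)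
    | add x _ y _ hx hy =>
      rw [map_add, add_sub_add_comm]
      exact add_mem hx hy
  have h := key q (mem_mul_of_mem_span_of_isHomogeneous_two hQ hqQ hq2)
  rwa [RingHom.mem_ker.mp (hker hqP), sub_zero, mul_comm] at h

end

end MvPolynomial

/-- Elements of a product of submodules are combinations of products of basis elements. -/
theorem Submodule.exists_eq_sum_of_mem_mul {k A ι κ : Type*} [CommSemiring k] [Semiring A]
    [Algebra k A] [Fintype ι] [Fintype κ] {P Q : Submodule k A} (b : Module.Basis ι k P)
    (b' : Module.Basis κ k Q) {q : A} (hq : q ∈ P * Q) :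
    ∃ c : ι → κ → k, q = ∑ i, ∑ j, c i j • ((b i : A) * b' j) := by
  induction hq using Submodule.mul_induction_on' with
  | mem_mul_mem x hx y hy =>
    refine ⟨fun i j => b.repr ⟨x, hx⟩ i * b'.repr ⟨y, hy⟩ j, ?_⟩
    have h₁ := congrArg Subtype.val (b.sum_repr ⟨x, hx⟩)
    have h₂ := congrArg Subtype.val (b'.sum_repr ⟨y, hy⟩)
    simp only [AddSubmonoidClass.coe_finsetSum, Submodule.coe_smul] at h₁ h₂
    conv_lhs => rw [← h₁, ← h₂, Finset.sum_mul_sum]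
    simp [smul_smul, mul_comm]
  | add x _ y _ hx hy =>
    obtain ⟨c, rfl⟩ := hx
    obtain ⟨c', rfl⟩ := hy
    exact ⟨c + c', by simp [add_smul, Finset.sum_add_distrib]⟩

/-- A bilinear form on `(ι ⊕ α → k) × (ι ⊕ β → k)` that vanishes on all pairs whose restrictions
to `ι` are opposite, and whose upper triangular entries on `ι` vanish, is zero. -/
theorem eq_zero_of_bilinear_vanishing {k ι α β : Type*} [Field k] [Fintype ι] [Fintype α]
    [Fintype β] [LinearOrder ι] {c : ι ⊕ α → ι ⊕ β → k}
    (h : ∀ (u : ι ⊕ α → k) (v : ι ⊕ β → k), (∀ i, u (Sum.inl i) + v (Sum.inl i) = 0) →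
      ∑ a, ∑ b, c a b * (u a * v b) = 0)
    (hlt : ∀ i j, i < j → c (Sum.inl i) (Sum.inl j) = 0) : c = 0 := by
  classical
  have single : ∀ (s : ι ⊕ α) (t : ι ⊕ β),
      ∑ a, ∑ b, c a b * ((Pi.single s 1 : _ → k) a * (Pi.single t 1 : _ → k) b) = c s t := by
    intro s t
    simp [Pi.single_apply]
  set B : (ι ⊕ α → k) → (ι ⊕ β → k) → k := fun u v => ∑ a, ∑ b, c a b * (u a * v b) with hB
  have addl : ∀ u u' v, B (u + u') v = B u v + B u' v := fun u u' v => by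
    simp [hB, add_mul, mul_add, Finset.sum_add_distrib, -Fintype.sum_sum_type]
  have addr : ∀ u v v', B u (v + v') = B u v + B u v' := fun u v v' => by
    simp [hB, mul_add, Finset.sum_add_distrib, -Fintype.sum_sum_type]
  have negr : ∀ u v, B u (-v) = -B u v := fun u v => by simp [hB, -Fintype.sum_sum_type]
  have hsingle : ∀ s t, B (Pi.single s 1) (Pi.single t 1) = c s t := single
  have hzero : ∀ u v, (∀ i, u (Sum.inl i) + v (Sum.inl i) = 0) → B u v = 0 := h
  clear_value B
  have diag : ∀ i, c (Sum.inl i) (Sum.inl i) = 0 := fun i => by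
    have := hzero (Pi.single (Sum.inl i) 1) (-Pi.single (Sum.inl i) 1)
      (fun j => by simp [Pi.single_apply])
    simpa [negr, hsingle] using this
  have alt : ∀ i j, c (Sum.inl i) (Sum.inl j) + c (Sum.inl j) (Sum.inl i) = 0 := fun i j => by
    have := hzero (Pi.single (Sum.inl i) 1 + Pi.single (Sum.inl j) 1)
      (-(Pi.single (Sum.inl i) 1 + Pi.single (Sum.inl j) 1))
      (fun l => by simp [Pi.single_apply])
    simp only [negr, addl, addr, hsingle, diag] at this
    linear_combination -this
  funext s t
  rcases s with i | a <;> rcases t with j | b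
  · rcases lt_trichotomy i j with hij | rfl | hij
    · exact hlt i j hij
    · exact diag i
    · simpa [hlt j i hij] using alt i j
  · have := hzero (Pi.single (Sum.inl i) 1) (-Pi.single (Sum.inl i) 1 + Pi.single (Sum.inr b) 1)
      (fun l => by simp [Pi.single_apply])
    simpa [negr, addr, hsingle, diag] using this
  · have := hzero (Pi.single (Sum.inl j) 1 + Pi.single (Sum.inr a) 1) (-Pi.single (Sum.inl j) 1)
      (fun l => by simp [Pi.single_apply])
    simpa [negr, addl, hsingle, diag] using this
  · have := hzero (Pi.single (Sum.inr a) 1) (Pi.single (Sum.inr b) 1) (fun l => by simp)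
    simpa [hsingle] using this

/-- Preimages in `P` of linearly independent vectors modulo `Q` are linearly independent. -/
theorem Submodule.linearIndependent_of_add_of_disjoint {k M ι : Type*} [Field k] [AddCommGroup M]
    [Module k M] {P Q K : Submodule k M} (hQK : Disjoint Q K) {z : ι → K}
    (hz : LinearIndependent k z) {x : ι → P} {y : ι → Q} (h : ∀ i, (x i : M) + y i = z i) :
    LinearIndependent k x := by
  rw [linearIndependent_iff] at hz ⊢
  intro l hl
  apply hz
  have hx : Finsupp.linearCombination k (fun i => (x i : M)) l = 0 := by
    have := congrArg P.subtype hl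
    rwa [map_zero, Finsupp.apply_linearCombination] at this
  have hyz : Q.subtype (Finsupp.linearCombination k y l) =
      K.subtype (Finsupp.linearCombination k z l) := by
    rw [Finsupp.apply_linearCombination, Finsupp.apply_linearCombination]
    have : K.subtype ∘ z = (fun i => (x i : M)) + Q.subtype ∘ y := by
      funext i
      simp [h]
    rw [this, Finsupp.linearCombination_apply, Finsupp.linearCombination_apply]
    rw [Finsupp.linearCombination_apply] at hx
    simp [smul_add, Finsupp.sum_add, hx]
  apply Subtype.ext
  refine Submodule.disjoint_def.mp hQK _ ?_ (Finsupp.linearCombination k z l).2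
  rw [← K.subtype_apply, ← hyz]
  exact (Finsupp.linearCombination k y l).2

/-- For subspaces `P₁, P₂, P₃` of linear forms of `k[x_1,…,x_n]`, each of
dimension `r` and pairwise intersecting trivially, the degree-2 component of
`I = (P₁) ∩ (P₂) ∩ (P₃)` has dimension `C(k₀, 2)`, where `k₀ = dim (P₃ ∩ (P₁ + P₂))`. -/
theorem dim_quadratic_part_three_linear_ideals
    {k : Type*} [Field k] {n : ℕ} (r : ℕ)
    (P₁ P₂ P₃ : Submodule k (MvPolynomial (Fin n) k))
    (h₁ : P₁ ≤ homogeneousSubmodule (Fin n) k 1)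
    (h₂ : P₂ ≤ homogeneousSubmodule (Fin n) k 1)
    (h₃ : P₃ ≤ homogeneousSubmodule (Fin n) k 1)
    (hd₁ : Module.finrank k P₁ = r)
    (hd₂ : Module.finrank k P₂ = r)
    (hd₃ : Module.finrank k P₃ = r)
    (h₁₂ : P₁ ⊓ P₂ = ⊥) (h₁₃ : P₁ ⊓ P₃ = ⊥) (h₂₃ : P₂ ⊓ P₃ = ⊥) :
    Module.finrank k
      ↥(Submodule.restrictScalars k
          (Ideal.span (P₁ : Set (MvPolynomial (Fin n) k)) ⊓
           Ideal.span (P₂ : Set (MvPolynomial (Fin n) k)) ⊓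
           Ideal.span (P₃ : Set (MvPolynomial (Fin n) k))) ⊓
        homogeneousSubmodule (Fin n) k 2) =
      Nat.choose (Module.finrank k ↥(P₃ ⊓ (P₁ ⊔ P₂))) 2 := by
  classical
  have hfin : Module.Finite k (homogeneousSubmodule (Fin n) k 1) :=
    Module.Finite.iff_fg.mpr (homogeneousSubmodule_fg _ _ 1)
  have : FiniteDimensional k P₁ := Submodule.finiteDimensional_of_le h₁
  have : FiniteDimensional k P₂ := Submodule.finiteDimensional_of_le h₂
  have : FiniteDimensional k P₃ := Submodule.finiteDimensional_of_le h₃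
  rw [← disjoint_iff] at h₁₂ h₁₃ h₂₃
  set K := P₃ ⊓ (P₁ ⊔ P₂) with hK
  have : FiniteDimensional k K := Submodule.finiteDimensional_of_le (inf_le_left : K ≤ P₃)
  let z := Module.finBasis k K
  have hz : ∀ i, ∃ (x : P₁) (y : P₂), (x : MvPolynomial (Fin n) k) + y = z i := fun i => by
    obtain ⟨x, hx, y, hy, h⟩ := Submodule.mem_sup.mp (z i).2.2
    exact ⟨⟨x, hx⟩, ⟨y, hy⟩, h⟩
  choose x y hxy using hz
  obtain ⟨A, bx, hbx⟩ := (Submodule.linearIndependent_of_add_of_disjoint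
    (h₂₃.mono_right inf_le_left) z.linearIndependent hxy).exists_basis_sum
  obtain ⟨B, b_y, hby⟩ := (Submodule.linearIndependent_of_add_of_disjoint
    (h₁₃.mono_right inf_le_left) z.linearIndependent
    (fun i => (add_comm _ _).trans (hxy i))).exists_basis_sum
  have : Finite (Fin (Module.finrank k K) ⊕ A) := Module.Finite.finite_basis bx
  have : Finite (Fin (Module.finrank k K) ⊕ B) := Module.Finite.finite_basis b_y
  have : Finite A := Finite.of_injective (Sum.inr : A → Fin (Module.finrank k K) ⊕ A)
    Sum.inr_injective
  have : Finite B := Finite.of_injective (Sum.inr : B → Fin (Module.finrank k K) ⊕ B)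
    Sum.inr_injective
  have := Fintype.ofFinite A
  have := Fintype.ofFinite B
  obtain ⟨D, hKD⟩ := K.exists_isCompl
  have hP₃ : P₃ ≤ K ⊔ D ⊓ P₃ := by
    rw [← sup_inf_assoc_of_le _ (inf_le_left : K ≤ P₃), hKD.sup_eq_top, top_inf_eq]
  have hD : Disjoint (P₁ ⊔ P₂) (D ⊓ P₃) := by
    rw [disjoint_iff, eq_bot_iff, ← hKD.inf_eq_bot]
    exact le_inf (le_inf (inf_le_right.trans inf_le_right) inf_le_left)
      (inf_le_right.trans inf_le_left)
  have hfun : ∀ (u : Fin (Module.finrank k K) ⊕ A → k) (v : Fin (Module.finrank k K) ⊕ B → k),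
      ∃ f : MvPolynomial (Fin n) k →ₗ[k] k,
        (∀ a, f (bx a) = u a) ∧ (∀ b, f (b_y b) = v b) ∧ ∀ w ∈ D ⊓ P₃, f w = 0 := by
    intro u v
    obtain ⟨f, hf, hf0⟩ := LinearMap.exists_extend_of_disjoint
      (h₁₂.disjoint_sup_right_of_disjoint_sup_left hD) (bx.constr k u)
    obtain ⟨g, hg, hg0⟩ := LinearMap.exists_extend_of_disjoint
      (h₁₂.symm.disjoint_sup_right_of_disjoint_sup_left (sup_comm P₁ P₂ ▸ hD)) (b_y.constr k v)
    refine ⟨f + g, fun a => ?_, fun b => ?_, fun w hw => ?_⟩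
    · simp [hf, hg0 _ (Submodule.mem_sup_left (bx a).2)]
    · simp [hg, hf0 _ (Submodule.mem_sup_left (b_y b).2)]
    · simp [hf0 w (Submodule.mem_sup_right hw), hg0 w (Submodule.mem_sup_right hw)]
  choose f hfx hfy hfD using hfun
  let E u v : MvPolynomial (Fin n) k →ₐ[k] k := aeval fun i => f u v (X i)
  have hE : ∀ u v a b, E u v (bx a * b_y b) = u a * v b := fun u v a b => by
    rw [map_mul, aeval_linearMap_of_mem_one _ (h₁ (bx a).2),
      aeval_linearMap_of_mem_one _ (h₂ (b_y b).2), hfx, hfy]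
  have hE₃ : ∀ u v, (∀ i, u (Sum.inl i) + v (Sum.inl i) = 0) →
      ∀ q ∈ Ideal.span (P₃ : Set (MvPolynomial (Fin n) k)), E u v q = 0 := by
    intro u v huv q hq
    have hker : Ideal.span (P₃ : Set (MvPolynomial (Fin n) k)) ≤ RingHom.ker (E u v) := by
      rw [Ideal.span_le]
      intro p hp
      rw [SetLike.mem_coe, RingHom.mem_ker, aeval_linearMap_of_mem_one _ (h₃ hp)]
      have hKer : K ⊔ D ⊓ P₃ ≤ LinearMap.ker (f u v) := by
        refine sup_le ?_ (fun w hw => hfD u v w hw)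
        rw [LinearMap.le_ker_iff_comp_subtype_eq_zero]
        refine z.ext fun i => ?_
        simp only [LinearMap.comp_apply, Submodule.subtype_apply, ← hxy, map_add, ← hbx, ← hby,
          hfx, hfy, huv, LinearMap.zero_apply]
      exact hKer (hP₃ hp)
    exact hker hq
  let T := (LinearMap.pi fun p : {p : Fin (Module.finrank k K) × Fin (Module.finrank k K) //
      p.1 < p.2} => (E (Pi.single (Sum.inl p.1.1) 1) (Pi.single (Sum.inl p.1.2) 1)).toLinearMap) ∘ₗ
    Submodule.subtype (Submodule.restrictScalars k
          (Ideal.span (P₁ : Set (MvPolynomial (Fin n) k)) ⊓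
           Ideal.span (P₂ : Set (MvPolynomial (Fin n) k)) ⊓
           Ideal.span (P₃ : Set (MvPolynomial (Fin n) k))) ⊓
        homogeneousSubmodule (Fin n) k 2)
  have hinj : Function.Injective T := by
    rw [← LinearMap.ker_eq_bot, LinearMap.ker_eq_bot']
    rintro ⟨q, ⟨⟨hq₁, hq₂⟩, hq₃⟩, hq⟩ hT
    obtain ⟨c, hc⟩ := Submodule.exists_eq_sum_of_mem_mul bx b_y
      (mem_mul_of_mem_span_of_mem_span h₁ h₂ h₁₂ hq₁ hq₂ hq)
    have hEq : ∀ u v, E u v q = ∑ a, ∑ b, c a b * (u a * v b) := fun u v => by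
      rw [hc]
      simp only [map_sum, map_smul, hE, smul_eq_mul]
    have hc0 : c = 0 := by
      refine eq_zero_of_bilinear_vanishing (fun u v huv => ?_) (fun i j hij => ?_)
      · rw [← hEq, hE₃ u v huv q hq₃]
      · have := congrFun hT ⟨(i, j), hij⟩
        change E (Pi.single (Sum.inl i) 1) (Pi.single (Sum.inl j) 1) q = 0 at this
        rw [hEq] at this
        simpa [Pi.single_apply] using this
    apply Subtype.ext
    simp [hc, hc0]
  have hmem : ∀ i j, (x i : MvPolynomial (Fin n) k) * y j - x j * y i ∈
      Submodule.restrictScalars k (Ideal.span (P₁ : Set (MvPolynomial (Fin n) k)) ⊓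
        Ideal.span (P₂ : Set (MvPolynomial (Fin n) k)) ⊓
        Ideal.span (P₃ : Set (MvPolynomial (Fin n) k))) ⊓ homogeneousSubmodule (Fin n) k 2 := by
    intro i j
    refine ⟨⟨⟨?_, ?_⟩, ?_⟩, ?_⟩
    · exact sub_mem (Ideal.mul_mem_right _ _ (Ideal.subset_span (x i).2))
        (Ideal.mul_mem_right _ _ (Ideal.subset_span (x j).2))
    · exact sub_mem (Ideal.mul_mem_left _ _ (Ideal.subset_span (y j).2))
        (Ideal.mul_mem_left _ _ (Ideal.subset_span (y i).2))
    · have : (x i : MvPolynomial (Fin n) k) * y j - x j * y i = z i * y j - z j * y i := by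
        rw [← hxy, ← hxy]
        ring
      rw [this]
      exact sub_mem (Ideal.mul_mem_right _ _ (Ideal.subset_span (z i).2.1))
        (Ideal.mul_mem_right _ _ (Ideal.subset_span (z j).2.1))
    · exact sub_mem (IsHomogeneous.mul (h₁ (x i).2) (h₂ (y j).2))
        (IsHomogeneous.mul (h₁ (x j).2) (h₂ (y i).2))
  have hsurj : Function.Surjective T := by
    intro g
    refine ⟨∑ p, g p • ⟨_, hmem p.1.1 p.1.2⟩, ?_⟩
    rw [map_sum]
    funext p
    rw [Finset.sum_apply, Finset.sum_eq_single p]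
    · rw [map_smul]
      change g p * E _ _ (x p.1.1 * y p.1.2 - x p.1.2 * y p.1.1) = g p
      simp only [map_sub, ← hbx, ← hby, hE]
      simp [p.2.ne, p.2.ne']
    · intro p' _ hp'
      rw [map_smul]
      change g p' * E _ _ (x p'.1.1 * y p'.1.2 - x p'.1.2 * y p'.1.1) = 0
      simp only [map_sub, ← hbx, ← hby, hE]
      obtain ⟨⟨i, j⟩, hij⟩ := p
      obtain ⟨⟨i', j'⟩, hij'⟩ := p'
      simp only [Pi.single_apply, Sum.inl.injEq]
      grind
    · simp
  rw [(LinearEquiv.ofBijective T ⟨hinj, hsurj⟩).finrank_eq, Module.finrank_fintype_fun_eq_card,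
    Fintype.card_subtype, Fintype.card_product_filter_lt, Fintype.card_fin]
end

section
/- Let k be a field and let x_1,...,x_k,y_1,...,y_k be 2k of the variables of a polynomial ring S over k (more generally, 2k linearly independent linear forms may be taken to be coordinates). Then the degree-2 homogeneous component of the ideal (x_1,...,x_k) ∩ (y_1,...,y_k) ∩ (x_1+y_1,...,x_k+y_k) is spanned as a k-vector space by the quadrics x_i y_j − x_j y_i for 1 ≤ i < j ≤ k. -/
open MvPolynomial

theorem Finsupp.eq_single_add_single_of_degree_eq_two {σ : Type*} {d : σ →₀ ℕ} {s t : σ}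
    (hst : s ≠ t) (hs : d s ≠ 0) (ht : d t ≠ 0) (hd : d.degree = 2) :
    d = Finsupp.single s 1 + Finsupp.single t 1 := by
  classical
  have hle : Finsupp.single s 1 + Finsupp.single t 1 ≤ d := by
    intro u
    rw [Finsupp.add_apply, Finsupp.single_apply, Finsupp.single_apply]
    split_ifs with h₁ h₂ h₂
    · exact absurd (h₁.trans h₂.symm) hst
    · subst h₁; omega
    · subst h₂; omega
    · omega
  obtain ⟨e, rfl⟩ := exists_add_of_le hle
  have he : e.degree = 0 := by
    simp only [map_add, Finsupp.degree_single] at hd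
    omega
  rw [Finsupp.degree_eq_zero_iff] at he
  simp [he]

namespace MvPolynomial

variable {k : Type*} [Field k] {σ : Type*} {m : ℕ}

theorem X_mul_X_eq_monomial (s t : σ) :
    (X s * X t : MvPolynomial σ k) = monomial (Finsupp.single s 1 + Finsupp.single t 1) 1 := by
  simp [X, monomial_mul]

/-- A quadratic form in `(x_i) ∩ (y_j)`, for disjoint families of variables, is bilinear. -/
theorem exists_eq_sum_X_mul_X {x y : Fin m → σ} (hxy : ∀ i j, x i ≠ y j)
    {F : MvPolynomial σ k} (hF : F.IsHomogeneous 2)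
    (hx : F ∈ Ideal.span (Set.range fun i => (X (x i) : MvPolynomial σ k)))
    (hy : F ∈ Ideal.span (Set.range fun i => (X (y i) : MvPolynomial σ k))) :
    ∃ a : Fin m × Fin m → k, ∑ p, a p • (X (x p.1) * X (y p.2)) = F := by
  rw [← Submodule.mem_span_range_iff_exists_fun k, F.as_sum]
  refine Submodule.sum_mem _ fun d hd => ?_
  rw [Set.range_comp' X x, mem_ideal_span_X_image] at hx
  rw [Set.range_comp' X y, mem_ideal_span_X_image] at hy
  obtain ⟨_, ⟨i, rfl⟩, hi⟩ := hx d hd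
  obtain ⟨_, ⟨j, rfl⟩, hj⟩ := hy d hd
  have hdeg : d.degree = 2 := by
    rw [Finsupp.degree_eq_weight_one]
    exact hF (mem_support_iff.mp hd)
  have hd' := Finsupp.eq_single_add_single_of_degree_eq_two (hxy i j) hi hj hdeg
  have : monomial d (coeff d F) = coeff d F • (X (x i) * X (y j)) := by
    rw [X_mul_X_eq_monomial, ← hd', smul_monomial, smul_eq_mul, mul_one]
  rw [this]
  exact Submodule.smul_mem _ _ (Submodule.subset_span ⟨(i, j), rfl⟩)

/-- The coefficients of a vanishing quadratic form are alternating. -/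
theorem alternating_of_sum_X_mul_X_eq_zero {a : Fin m × Fin m → k}
    (h : ∑ p, a p • (X p.1 * X p.2 : MvPolynomial (Fin m) k) = 0) :
    (∀ i, a (i, i) = 0) ∧ ∀ i j, i ≠ j → a (i, j) + a (j, i) = 0 := by
  classical
  have key (i j : Fin m) :
      ∑ p : Fin m × Fin m, (if p = (i, j) ∨ p = (j, i) then a p else 0) = 0 := by
    have hc := congrArg (coeff (Finsupp.single i 1 + Finsupp.single j 1)) h
    rw [coeff_sum, coeff_zero] at hc
    refine (Finset.sum_congr rfl fun p _ => ?_).trans hc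
    rw [X_mul_X_eq_monomial, coeff_smul, coeff_monomial]
    have : Finsupp.single p.1 1 + Finsupp.single p.2 1 =
        Finsupp.single i 1 + Finsupp.single j 1 ↔ p = (i, j) ∨ p = (j, i) := by
      rw [Finsupp.single_add_single_eq_single_add_single one_ne_zero one_ne_zero]
      simp [Prod.ext_iff]
    simp [this]
  refine ⟨fun i => by simpa using key i i, fun i j hij => ?_⟩
  rw [← key i j, ← Finset.sum_filter]
  have : Finset.univ.filter (fun p : Fin m × Fin m => p = (i, j) ∨ p = (j, i)) =
      {(i, j), (j, i)} := by
    ext p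
    simp
  rw [this, Finset.sum_pair (by simp [hij])]

/-- A bilinear form in `x, y` lying in the ideal `(x_i + y_i)` has alternating coefficients. -/
theorem alternating_of_sum_mem_span_add {x y : Fin m → σ}
    (hinj : Function.Injective (Sum.elim x y : Fin m ⊕ Fin m → σ)) {a : Fin m × Fin m → k}
    (h : ∑ p, a p • (X (x p.1) * X (y p.2)) ∈
      Ideal.span (Set.range fun i => (X (x i) + X (y i) : MvPolynomial σ k))) :
    (∀ i, a (i, i) = 0) ∧ ∀ i j, i ≠ j → a (i, j) + a (j, i) = 0 := by
  let v : σ → MvPolynomial (Fin m) k :=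
    Function.extend (Sum.elim x y) (Sum.elim X fun i => -X i) 0
  have hvx (i : Fin m) : v (x i) = X i := hinj.extend_apply _ _ (Sum.inl i)
  have hvy (i : Fin m) : v (y i) = -X i := hinj.extend_apply _ _ (Sum.inr i)
  have hker : Ideal.span (Set.range fun i => (X (x i) + X (y i) : MvPolynomial σ k)) ≤
      RingHom.ker (aeval (R := k) v) := by
    rw [Ideal.span_le]
    rintro _ ⟨i, rfl⟩
    simp [RingHom.mem_ker, hvx, hvy]
  have hzero := hker h
  rw [RingHom.mem_ker] at hzero
  refine alternating_of_sum_X_mul_X_eq_zero ?_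
  simpa [hvx, hvy] using hzero

/-- A bilinear form with alternating coefficients is a combination of `2 × 2` minors. -/
theorem sum_mem_span_minors (x y : Fin m → σ) {a : Fin m × Fin m → k}
    (ha : ∀ i, a (i, i) = 0) (ha' : ∀ i j, i ≠ j → a (i, j) + a (j, i) = 0) :
    ∑ p, a p • (X (x p.1) * X (y p.2) : MvPolynomial σ k) ∈ Submodule.span k
      {q : MvPolynomial σ k | ∃ i j : Fin m, i < j ∧
        q = X (x i) * X (y j) - X (x j) * X (y i)} := by
  set W := Submodule.span k {q : MvPolynomial σ k | ∃ i j : Fin m, i < j ∧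
    q = X (x i) * X (y j) - X (x j) * X (y i)}
  have hlt {i j : Fin m} (hij : i < j) :
      W.mkQ (X (x i) * X (y j)) = W.mkQ (X (x j) * X (y i)) := by
    rw [← sub_eq_zero, ← map_sub, ← LinearMap.mem_ker, Submodule.ker_mkQ]
    exact Submodule.subset_span ⟨i, j, hij, rfl⟩
  have hsymm (i j : Fin m) : W.mkQ (X (x i) * X (y j)) = W.mkQ (X (x j) * X (y i)) := by
    rcases lt_trichotomy i j with hij | rfl | hij
    · exact hlt hij
    · rfl
    · exact (hlt hij).symm
  rw [← Submodule.ker_mkQ W, LinearMap.mem_ker, map_sum]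
  simp only [map_smul]
  refine Finset.sum_involution (fun p _ => p.swap) ?_ ?_ (fun _ _ => Finset.mem_univ _)
    (fun p _ => p.swap_swap)
  · rintro ⟨i, j⟩ -
    by_cases hij : i = j
    · subst hij
      simp [ha]
    · simp only [Prod.swap_prod_mk]
      rw [hsymm j i, ← add_smul, ha' i j hij, zero_smul]
  · rintro ⟨i, j⟩ - hne heq
    obtain rfl : j = i := congrArg Prod.fst heq
    exact hne (by simp [ha])

/-- The `2 × 2` minors lie in all three linear ideals. -/
theorem minor_mem_inf_span (x y : Fin m → σ) (i j : Fin m) :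
    (X (x i) * X (y j) - X (x j) * X (y i) : MvPolynomial σ k) ∈
      Ideal.span (Set.range fun i => (X (x i) : MvPolynomial σ k)) ⊓
        Ideal.span (Set.range fun i => (X (y i) : MvPolynomial σ k)) ⊓
        Ideal.span (Set.range fun i => (X (x i) + X (y i) : MvPolynomial σ k)) := by
  refine ⟨⟨?_, ?_⟩, ?_⟩
  · exact sub_mem (Ideal.mul_mem_right _ _ (Ideal.subset_span ⟨i, rfl⟩))
      (Ideal.mul_mem_right _ _ (Ideal.subset_span ⟨j, rfl⟩))
  · exact sub_mem (Ideal.mul_mem_left _ _ (Ideal.subset_span ⟨j, rfl⟩))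
      (Ideal.mul_mem_left _ _ (Ideal.subset_span ⟨i, rfl⟩))
  · have h : (X (x i) * X (y j) - X (x j) * X (y i) : MvPolynomial σ k) =
        X (x i) * (X (x j) + X (y j)) - X (x j) * (X (x i) + X (y i)) := by ring
    rw [h]
    exact sub_mem (Ideal.mul_mem_left _ _ (Ideal.subset_span ⟨j, rfl⟩))
      (Ideal.mul_mem_left _ _ (Ideal.subset_span ⟨i, rfl⟩))

end MvPolynomial

/-- Let `x_1,…,x_m, y_1,…,y_m` be distinct variables of a polynomial ring
`S = k[σ]`. Then the degree-2 homogeneous component of the ideal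
`(x_1,…,x_m) ∩ (y_1,…,y_m) ∩ (x_1+y_1,…,x_m+y_m)` is spanned over `k` by the quadrics
`x_i y_j − x_j y_i` for `i < j`. -/
theorem quadratic_part_of_segre_type_intersection
    {k : Type*} [Field k] {σ : Type*} (m : ℕ) (x y : Fin m → σ)
    (hinj : Function.Injective (Sum.elim x y : Fin m ⊕ Fin m → σ)) :
    (Submodule.restrictScalars k
        (Ideal.span (Set.range fun i => (X (x i) : MvPolynomial σ k)) ⊓
         Ideal.span (Set.range fun i => (X (y i) : MvPolynomial σ k)) ⊓
         Ideal.span (Set.range fun i => (X (x i) + X (y i) : MvPolynomial σ k))) ⊓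
      homogeneousSubmodule σ k 2) =
    Submodule.span k
      {q : MvPolynomial σ k | ∃ i j : Fin m, i < j ∧
        q = X (x i) * X (y j) - X (x j) * X (y i)} := by
  apply le_antisymm
  · rintro F ⟨⟨⟨hx, hy⟩, hxy⟩, hF⟩
    have hne (i j : Fin m) : x i ≠ y j := fun h =>
      Sum.inl_ne_inr (hinj (a₁ := Sum.inl i) (a₂ := Sum.inr j) h)
    obtain ⟨a, rfl⟩ := exists_eq_sum_X_mul_X hne hF hx hy
    obtain ⟨ha, ha'⟩ := alternating_of_sum_mem_span_add hinj hxy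
    exact sum_mem_span_minors x y ha ha'
  · rw [Submodule.span_le]
    rintro _ ⟨i, j, -, rfl⟩
    exact ⟨minor_mem_inf_span x y i j,
      ((isHomogeneous_X k _).mul (isHomogeneous_X k _)).sub
        ((isHomogeneous_X k _).mul (isHomogeneous_X k _))⟩
end

section
/- Let k be a field and S = k[x_1,...,x_n]. If P_1, P_2 are subspaces of the space of linear forms with P_1 ∩ P_2 = 0, then the intersection of the ideals they generate equals their product: (P_1) ∩ (P_2) = (P_1) · (P_2). -/
open MvPolynomial

/-- If an endomorphism `φ` of a commutative ring is the identity modulo `I` and fixes `t`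
pointwise, then it is the identity on `Ideal.span t` modulo `I * Ideal.span t`. -/
theorem Ideal.sub_map_mem_mul_span {R : Type*} [CommRing R] {I : Ideal R} {t : Set R}
    (φ : R →+* R) (hI : ∀ a, a - φ a ∈ I) (ht : ∀ x ∈ t, φ x = x) {f : R}
    (hf : f ∈ Ideal.span t) : f - φ f ∈ I * Ideal.span t := by
  induction hf using Submodule.span_induction with
  | mem x hx => simp [ht x hx]
  | zero => simp
  | add x y _ _ hx hy =>
    rw [map_add, add_sub_add_comm]
    exact add_mem hx hy
  | smul a x hx ih =>
    have h : a • x - φ (a • x) = (a - φ a) * x + φ a * (x - φ x) := by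
      rw [smul_eq_mul, map_mul]
      ring
    rw [h]
    exact add_mem (Ideal.mul_mem_mul (hI a) hx) (Ideal.mul_mem_left _ _ ih)

/-- If some ring endomorphism is the identity modulo `Ideal.span s`, kills `s` and fixes `t`
pointwise, then the intersection of the ideals spanned by `s` and `t` is their product. -/
theorem Ideal.span_inf_span_eq_mul_of_endomorphism {R : Type*} [CommRing R] {s t : Set R}
    (φ : R →+* R) (hφ : ∀ a, a - φ a ∈ Ideal.span s) (hs : ∀ x ∈ s, φ x = 0)
    (ht : ∀ x ∈ t, φ x = x) :
    Ideal.span s ⊓ Ideal.span t = Ideal.span s * Ideal.span t := by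
  refine le_antisymm (fun f hf ↦ ?_) Ideal.mul_le_inf
  have hker : Ideal.span s ≤ RingHom.ker φ := Ideal.span_le.2 hs
  have hzero : φ f = 0 := hker hf.1
  simpa [hzero] using Ideal.sub_map_mem_mul_span φ hφ ht hf.2

/-- An algebra endomorphism of a polynomial ring is the identity modulo an ideal as soon as it is
so on the variables. -/
theorem MvPolynomial.sub_algHom_mem {σ R : Type*} [CommRing R] {I : Ideal (MvPolynomial σ R)}
    (φ : MvPolynomial σ R →ₐ[R] MvPolynomial σ R) (hX : ∀ i, X i - φ (X i) ∈ I)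
    (p : MvPolynomial σ R) : p - φ p ∈ I := by
  have h : (Ideal.Quotient.mkₐ R I).comp φ = Ideal.Quotient.mkₐ R I :=
    MvPolynomial.algHom_ext fun i ↦ (Ideal.Quotient.eq.2 (hX i)).symm
  exact Ideal.Quotient.eq.1 (DFunLike.congr_fun h p).symm

/-- Substituting `π (X i)` for `X i` agrees with the linear map `π` on linear forms. -/
theorem MvPolynomial.aeval_linearMap_X_of_mem {σ R : Type*} [CommRing R]
    (π : MvPolynomial σ R →ₗ[R] MvPolynomial σ R) {p : MvPolynomial σ R}
    (hp : p ∈ homogeneousSubmodule σ R 1) : aeval (fun i ↦ π (X i)) p = π p := by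
  rw [homogeneousSubmodule_one_eq_span_X] at hp
  refine LinearMap.eqOn_span (f := (aeval fun i ↦ π (X i)).toLinearMap) ?_ hp
  rintro _ ⟨i, rfl⟩
  simp

/-- If `P₁, P₂` are subspaces of the space of linear forms of
`k[x_1,…,x_n]` with `P₁ ∩ P₂ = 0`, then `(P₁) ∩ (P₂) = (P₁) · (P₂)`. -/
theorem inf_eq_mul_of_disjoint_linear_ideals
    {k : Type*} [Field k] {n : ℕ}
    (P₁ P₂ : Submodule k (MvPolynomial (Fin n) k))
    (h₁ : P₁ ≤ homogeneousSubmodule (Fin n) k 1)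
    (h₂ : P₂ ≤ homogeneousSubmodule (Fin n) k 1)
    (h₁₂ : P₁ ⊓ P₂ = ⊥) :
    Ideal.span (P₁ : Set (MvPolynomial (Fin n) k)) ⊓
      Ideal.span (P₂ : Set (MvPolynomial (Fin n) k)) =
    Ideal.span (P₁ : Set (MvPolynomial (Fin n) k)) *
      Ideal.span (P₂ : Set (MvPolynomial (Fin n) k)) := by
  obtain ⟨Q, hQ, hcompl⟩ := (disjoint_iff.2 h₁₂).symm.exists_isCompl
  set π := Q.projection P₁ hcompl
  refine Ideal.span_inf_span_eq_mul_of_endomorphism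
    (aeval fun i ↦ π (X i) : MvPolynomial (Fin n) k →ₐ[k] MvPolynomial (Fin n) k).toRingHom
    (MvPolynomial.sub_algHom_mem _ fun i ↦ ?_) (fun p hp ↦ ?_) (fun p hp ↦ ?_)
  · rw [aeval_X]
    exact Ideal.subset_span (Submodule.sub_projection_mem hcompl (X i))
  · exact (MvPolynomial.aeval_linearMap_X_of_mem π (h₁ hp)).trans
      (Submodule.projection_apply_of_mem_right hcompl hp)
  · exact (MvPolynomial.aeval_linearMap_X_of_mem π (h₂ hp)).trans
      (Submodule.projection_apply_of_mem_left hcompl (hQ hp))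
end

section
/- Let k be a field and S = k[x_1,...,x_n]. Let f be a homogeneous cubic contained in the ideal I = (P_1) ∩ ... ∩ (P_s), where P_1,...,P_s are subspaces of linear forms with P_1 ∩ ... ∩ P_s = 0, and set W = P_1 + ... + P_s. Then f depends on at most dim W + dim I_2 variables, i.e., there exists a subspace V of the space of linear forms with dim V ≤ dim W + dim I_2 such that f lies in the k-subalgebra of S generated by V. -/
open MvPolynomial

namespace MvPolynomial

variable {σ k : Type*}

section CommRing

variable [CommRing k]

/-- Polynomials in `X` over `k[Y]` all of whose monomials have total bidegree sum `d`. -/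
def bihomogeneousSubmodule (σ k : Type*) [CommRing k] (d : ℕ) :
    Submodule k (MvPolynomial σ (MvPolynomial σ k)) where
  carrier := {F | ∀ a b, coeff b (coeff a F) ≠ 0 → b.degree + a.degree = d}
  zero_mem' := by simp
  add_mem' := by
    intro F G hF hG a b h
    by_contra hne
    have hFz : coeff b (coeff a F) = 0 := not_imp_comm.1 (hF a b) hne
    have hGz : coeff b (coeff a G) = 0 := not_imp_comm.1 (hG a b) hne
    exact h (by rw [coeff_add, coeff_add, hFz, hGz, add_zero])
  smul_mem' := by
    intro c F hF a b h
    refine hF a b fun h0 => h ?_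
    rw [coeff_smul, coeff_smul, h0, smul_zero]

theorem mem_bihomogeneousSubmodule {d : ℕ} {F : MvPolynomial σ (MvPolynomial σ k)} :
    F ∈ bihomogeneousSubmodule σ k d ↔
      ∀ a b, coeff b (coeff a F) ≠ 0 → b.degree + a.degree = d := Iff.rfl

theorem C_mem_bihomogeneousSubmodule {d : ℕ} {f : MvPolynomial σ k} (hf : f.IsHomogeneous d) :
    C f ∈ bihomogeneousSubmodule σ k d := by
  classical
  intro a b h
  rw [coeff_C] at h
  split_ifs at h with ha
  · subst ha
    rw [Finsupp.degree_eq_weight_one]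
    simpa using! hf h
  · simp at h

theorem map_C_mem_bihomogeneousSubmodule {d : ℕ} {f : MvPolynomial σ k}
    (hf : f.IsHomogeneous d) : map C f ∈ bihomogeneousSubmodule σ k d := by
  classical
  intro a b h
  rw [coeff_map, coeff_C] at h
  split_ifs at h with hb
  · subst hb
    rw [Finsupp.degree_eq_weight_one]
    simpa using! hf h
  · simp at h

instance bihomogeneousSubmodule.gradedMonoid :
    SetLike.GradedMonoid (bihomogeneousSubmodule σ k) where
  one_mem := by
    rw [← C_1]
    exact C_mem_bihomogeneousSubmodule (isHomogeneous_one σ k)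
  mul_mem := by
    classical
    intro d e F G hF hG a b h
    rw [coeff_mul, coeff_sum] at h
    obtain ⟨x, hx, h⟩ := Finset.exists_ne_zero_of_sum_ne_zero h
    rw [coeff_mul] at h
    obtain ⟨y, hy, h⟩ := Finset.exists_ne_zero_of_sum_ne_zero h
    rw [Finset.HasAntidiagonal.mem_antidiagonal] at hx hy
    have hF' := hF _ _ (left_ne_zero_of_mul h)
    have hG' := hG _ _ (right_ne_zero_of_mul h)
    rw [← hx, ← hy, map_add, map_add]
    omega

theorem IsHomogeneous.aeval_mem_bihomogeneousSubmodule {d : ℕ} {f : MvPolynomial σ k}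
    (hf : f.IsHomogeneous d) {g : σ → MvPolynomial σ (MvPolynomial σ k)}
    (hg : ∀ i, g i ∈ bihomogeneousSubmodule σ k 1) :
    MvPolynomial.aeval g f ∈ bihomogeneousSubmodule σ k d := by
  rw [aeval_def, eval₂_eq]
  refine Submodule.sum_mem _ fun a ha => ?_
  rw [← Algebra.smul_def]
  refine Submodule.smul_mem _ _ ?_
  have h := SetLike.prod_pow_mem_graded (bihomogeneousSubmodule σ k) (fun _ => 1) g
    (F := a.support) a fun i _ => hg i
  have hd : ∑ i ∈ a.support, a i • 1 = d := by
    have : Finsupp.weight (fun _ => 1) a = d := hf (mem_support_iff.1 ha)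
    rw [← Finsupp.degree_eq_weight_one] at this
    simpa [Finsupp.degree_apply] using this
  rwa [hd] at h

/-- Polynomials all of whose coefficients lie in the subalgebra `A`. -/
def coeffsInSubalgebra {S : Type*} [CommRing S] [Algebra k S] (σ : Type*) (A : Subalgebra k S) :
    Subalgebra k (MvPolynomial σ S) where
  carrier := {F | ∀ a, coeff a F ∈ A}
  mul_mem' := by
    classical
    intro F G hF hG a
    rw [coeff_mul]
    exact sum_mem fun x _ => mul_mem (hF _) (hG _)
  add_mem' := by
    intro F G hF hG a
    rw [coeff_add]
    exact add_mem (hF _) (hG _)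
  algebraMap_mem' := by
    classical
    intro r a
    rw [algebraMap_apply, coeff_C]
    split_ifs
    · exact A.algebraMap_mem r
    · exact zero_mem A

/-- An ideal generated by linear forms contains no linear forms besides the span of its
generators, and no nonzero constants. -/
theorem coeff_zero_and_homogeneousComponent_one_of_mem_span
    {P : Submodule k (MvPolynomial σ k)} (hP : P ≤ homogeneousSubmodule σ k 1)
    {f : MvPolynomial σ k} (hf : f ∈ Ideal.span (P : Set (MvPolynomial σ k))) :
    coeff 0 f = 0 ∧ homogeneousComponent 1 f ∈ P := by
  classical
  have hlin : ∀ p ∈ P, coeff 0 p = 0 := fun p hp =>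
    (hP hp : p.IsHomogeneous 1).coeff_eq_zero (by simp)
  refine Submodule.closure_induction (p := fun f _ => coeff 0 f = 0 ∧ homogeneousComponent 1 f ∈ P)
    ?_ ?_ ?_ hf
  · simp
  · rintro f g - - ⟨hf0, hf1⟩ ⟨hg0, hg1⟩
    refine ⟨by rw [coeff_add, hf0, hg0, add_zero], ?_⟩
    rw [map_add]
    exact add_mem hf1 hg1
  · intro r p hp
    refine ⟨by simp [coeff_mul, hlin p hp], ?_⟩
    let := gradedAlgebra (σ := σ) (R := k)
    have h := DirectSum.coe_decompose_mul_of_right_mem_of_le (homogeneousSubmodule σ k)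
      (a := r) (hP hp) le_rfl
    have e (φ : MvPolynomial σ k) (i : ℕ) :
        (DirectSum.decompose (homogeneousSubmodule σ k) φ i : MvPolynomial σ k) =
          homogeneousComponent i φ := decomposition.decompose'_apply φ i
    rw [e, e, Nat.sub_self, homogeneousComponent_zero] at h
    rw [smul_eq_mul, h, ← smul_eq_C_mul]
    exact P.smul_mem _ hp

theorem eq_zero_of_isHomogeneous_le_one {ι : Type*} {P : ι → Submodule k (MvPolynomial σ k)}
    [Nontrivial k]
    (hlin : ∀ i, P i ≤ homogeneousSubmodule σ k 1) (hint : (⨅ i, P i) = ⊥)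
    {f : MvPolynomial σ k} {d : ℕ} (hd : d ≤ 1) (hf : f.IsHomogeneous d)
    (hfI : ∀ i, f ∈ Ideal.span (P i : Set (MvPolynomial σ k))) : f = 0 := by
  have h i := coeff_zero_and_homogeneousComponent_one_of_mem_span (hlin i) (hfI i)
  obtain rfl | rfl : d = 0 ∨ d = 1 := by omega
  · have : Nonempty ι := by
      by_contra hι
      rw [not_nonempty_iff] at hι
      rw [iInf_of_empty] at hint
      exact top_ne_bot hint
    have h0 := (h (Classical.arbitrary ι)).1
    rw [← totalDegree_zero_iff_isHomogeneous, totalDegree_eq_zero_iff_eq_C] at hf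
    rw [hf, h0, C_0]
  · have hf1 : homogeneousComponent 1 f ∈ ⨅ i, P i := (Submodule.mem_iInf _).2 fun i => (h i).2
    rw [hint, Submodule.mem_bot] at hf1
    rwa [homogeneousComponent_of_mem hf, if_pos rfl] at hf1

end CommRing

section Field

variable [Field k]

/-- A form `f` has an expansion `f = ∑ gₐ xᵃ` whose coefficients are forms in the linear forms
of `W`, and lie in every ideal containing `f` generated by a subspace of `W`. -/
theorem exists_expansion {W : Submodule k (MvPolynomial σ k)}
    (hW : W ≤ homogeneousSubmodule σ k 1) {f : MvPolynomial σ k} {d : ℕ}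
    (hf : f.IsHomogeneous d) :
    ∃ G : MvPolynomial σ (MvPolynomial σ k), eval X G = f ∧
      G ∈ bihomogeneousSubmodule σ k d ∧
      (∀ a, coeff a G ∈ Algebra.adjoin k (W : Set (MvPolynomial σ k))) ∧
      ∀ Q ≤ W, f ∈ Ideal.span (Q : Set (MvPolynomial σ k)) →
        ∀ a, coeff a G ∈ Ideal.span (Q : Set (MvPolynomial σ k)) := by
  obtain ⟨π, hπ⟩ := (LinearMap.id : W →ₗ[k] W).exists_extend
  have hπW (w : W) : π w = w := LinearMap.congr_fun hπ w
  let g : σ → MvPolynomial σ (MvPolynomial σ k) := fun i =>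
    C (π (X i) : MvPolynomial σ k) + map C (X i - (π (X i) : MvPolynomial σ k))
  have hg (w) (hw : w ∈ W) : aeval g w = C w := by
    let L : MvPolynomial σ k →ₗ[k] MvPolynomial σ (MvPolynomial σ k) :=
      (IsScalarTower.toAlgHom k (MvPolynomial σ k) _).toLinearMap ∘ₗ W.subtype ∘ₗ π +
        (mapAlgHom (Algebra.ofId k (MvPolynomial σ k))).toLinearMap ∘ₗ
          (LinearMap.id - W.subtype ∘ₗ π)
    have hL (p) : L p = C (π p : MvPolynomial σ k) + map C (p - (π p : MvPolynomial σ k)) := rfl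
    have hspan : w ∈ Submodule.span k (Set.range X) := by
      rw [← homogeneousSubmodule_one_eq_span_X]
      exact hW hw
    have h : aeval g w = L w := by
      refine LinearMap.eqOn_span' (f := (aeval g).toLinearMap) (g := L) ?_ hspan
      rintro _ ⟨i, rfl⟩
      simp [hL, g]
    rw [h, hL, hπW ⟨w, hw⟩, sub_self, map_zero, add_zero]
  refine ⟨aeval g f, ?_, ?_, ?_, ?_⟩
  · have h : ((aeval X : MvPolynomial σ (MvPolynomial σ k) →ₐ[MvPolynomial σ k] _).restrictScalars
        k).comp (aeval g) = AlgHom.id k _ := by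
      ext1 i
      have hid (p : MvPolynomial σ k) :
          (aeval X : _ →ₐ[MvPolynomial σ k] MvPolynomial σ k) (map C p) = p := by
        rw [← algebraMap_eq, aeval_map_algebraMap, aeval_X_left_apply]
      rw [AlgHom.comp_apply, aeval_X, AlgHom.restrictScalars_apply, map_add, hid, ← algebraMap_eq,
        AlgHom.commutes, Algebra.algebraMap_self_apply, add_sub_cancel, AlgHom.id_apply]
    simpa using! AlgHom.congr_fun h f
  · refine hf.aeval_mem_bihomogeneousSubmodule fun i => ?_
    exact add_mem (C_mem_bihomogeneousSubmodule (hW (π (X i)).2))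
      (map_C_mem_bihomogeneousSubmodule
        ((homogeneousSubmodule σ k 1).sub_mem (isHomogeneous_X k i) (hW (π (X i)).2)))
  · have hA (i) : g i ∈ coeffsInSubalgebra σ (Algebra.adjoin k (W : Set (MvPolynomial σ k))) := by
      classical
      intro a
      rw [coeff_add, coeff_map, coeff_C]
      refine add_mem ?_ (Subalgebra.algebraMap_mem _ _)
      split_ifs
      · exact Algebra.subset_adjoin (π (X i)).2
      · exact zero_mem _
    have h : (aeval g).range ≤ coeffsInSubalgebra σ (Algebra.adjoin k (W : Set _)) := by
      rw [← Algebra.adjoin_range_eq_range_aeval, Algebra.adjoin_le_iff]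
      rintro _ ⟨i, rfl⟩
      exact hA i
    exact h ⟨f, rfl⟩
  · intro Q hQ hfQ
    rw [← mem_map_C_iff]
    have h : Ideal.span (Q : Set (MvPolynomial σ k)) ≤
        ((Ideal.span (Q : Set (MvPolynomial σ k))).map C).comap (aeval g) := by
      rw [Ideal.span_le]
      intro q hq
      rw [SetLike.mem_coe, Ideal.mem_comap, hg q (hQ hq)]
      exact Ideal.mem_map_of_mem _ (Ideal.subset_span hq)
    exact h hfQ

variable {ι : Type*} {P : ι → Submodule k (MvPolynomial σ k)}

/-- A form of degree `d` in `⋂ (Pᵢ)`, where `⋂ Pᵢ = 0`, is `∑ gₐ xᵃ` over monomials of degree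
at most `d - 2`, with coefficients forms in `⋂ (Pᵢ)` in the linear forms of `∑ Pᵢ`. -/
theorem exists_expansion_of_mem_iInf_span
    (hlin : ∀ i, P i ≤ homogeneousSubmodule σ k 1) (hint : (⨅ i, P i) = ⊥)
    {f : MvPolynomial σ k} {d : ℕ} (hf : f.IsHomogeneous d)
    (hfI : f ∈ ⨅ i, Ideal.span (P i : Set (MvPolynomial σ k))) :
    ∃ G : MvPolynomial σ (MvPolynomial σ k), eval X G = f ∧ ∀ a,
      coeff a G ∈ Algebra.adjoin k ((⨆ i, P i : Submodule k _) : Set (MvPolynomial σ k)) ∧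
      coeff a G ∈ ⨅ i, Ideal.span (P i : Set (MvPolynomial σ k)) ∧
      (coeff a G).IsHomogeneous (d - a.degree) ∧ (coeff a G ≠ 0 → a.degree + 2 ≤ d) := by
  obtain ⟨G, hGf, hGd, hGW, hGI⟩ := exists_expansion (iSup_le hlin) hf
  have hI (a i) : coeff a G ∈ Ideal.span (P i : Set (MvPolynomial σ k)) :=
    hGI _ (le_iSup P i) ((Submodule.mem_iInf _).1 hfI i) a
  have hd (a) : (coeff a G).IsHomogeneous (d - a.degree) := by
    intro b hb
    have := hGd a b hb
    change Finsupp.weight (fun _ => 1) b = _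
    rw [← Finsupp.degree_eq_weight_one]
    omega
  refine ⟨G, hGf, fun a => ⟨hGW a, (Submodule.mem_iInf _).2 (hI a), hd a, fun h => ?_⟩⟩
  by_contra hlt
  exact h (eq_zero_of_isHomogeneous_le_one hlin hint (by omega) (hd a) (hI a))

/-- A quadric in `⋂ (Pᵢ)`, where `⋂ Pᵢ = 0`, is a polynomial in the linear forms of `∑ Pᵢ`. -/
theorem IsHomogeneous.mem_adjoin_of_mem_iInf_span
    (hlin : ∀ i, P i ≤ homogeneousSubmodule σ k 1) (hint : (⨅ i, P i) = ⊥)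
    {f : MvPolynomial σ k} (hf : f.IsHomogeneous 2)
    (hfI : f ∈ ⨅ i, Ideal.span (P i : Set (MvPolynomial σ k))) :
    f ∈ Algebra.adjoin k ((⨆ i, P i : Submodule k _) : Set (MvPolynomial σ k)) := by
  obtain ⟨G, rfl, hG⟩ := exists_expansion_of_mem_iInf_span hlin hint hf hfI
  rw [eval_eq]
  refine sum_mem fun a ha => ?_
  have ha0 : a = 0 := by
    rw [← Finsupp.degree_eq_zero_iff]
    have := (hG a).2.2.2 (mem_support_iff.1 ha)
    omega
  subst ha0
  simpa using (hG 0).1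

end Field

end MvPolynomial

/-- Let `f` be a homogeneous cubic lying in `I = (P_1) ∩ ⋯ ∩ (P_s)`, where
the `P_i` are subspaces of linear forms with trivial common intersection, and let
`W = P_1 + ⋯ + P_s`. Then `f` depends on at most `dim W + dim I_2` variables: there is a
subspace `V` of linear forms with `dim V ≤ dim W + dim I_2` and `f` in the subalgebra
generated by `V`. -/
theorem cubic_depends_on_few_variables
    {k : Type*} [Field k] {n : ℕ} (s : ℕ)
    (P : Fin s → Submodule k (MvPolynomial (Fin n) k))
    (hlin : ∀ i, P i ≤ homogeneousSubmodule (Fin n) k 1)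
    (hint : (⨅ i, P i) = ⊥)
    (f : MvPolynomial (Fin n) k) (hf : f.IsHomogeneous 3)
    (hfI : f ∈ ⨅ i, Ideal.span ((P i : Set (MvPolynomial (Fin n) k)))) :
    ∃ V : Submodule k (MvPolynomial (Fin n) k),
      V ≤ homogeneousSubmodule (Fin n) k 1 ∧
      Module.finrank k V ≤
        Module.finrank k ↥(⨆ i, P i) +
        Module.finrank k
          ↥(Submodule.restrictScalars k
              (⨅ i, Ideal.span ((P i : Set (MvPolynomial (Fin n) k)))) ⊓
            homogeneousSubmodule (Fin n) k 2) ∧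
      f ∈ Algebra.adjoin k (V : Set (MvPolynomial (Fin n) k)) := by
  classical
  set I := ⨅ i, Ideal.span ((P i : Set (MvPolynomial (Fin n) k)))
  set I₂ := Submodule.restrictScalars k I ⊓ homogeneousSubmodule (Fin n) k 2
  set W := ⨆ i, P i
  have hfin (d : ℕ) : FiniteDimensional k (homogeneousSubmodule (Fin n) k d) :=
    Module.Finite.iff_fg.2 (homogeneousSubmodule_fg (Fin n) k d)
  have : FiniteDimensional k I₂ := Submodule.finiteDimensional_of_le inf_le_right
  have hW1 : W ≤ homogeneousSubmodule (Fin n) k 1 := iSup_le hlin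
  have : FiniteDimensional k W := Submodule.finiteDimensional_of_le hW1
  obtain ⟨G, hGf, hG⟩ := exists_expansion_of_mem_iInf_span hlin hint hf hfI
  have hdeg (a) (ha : a ∈ G.support) : a.degree ≤ 1 := by
    have := (hG a).2.2.2 (mem_support_iff.1 ha)
    omega
  let e := Module.finBasis k I₂
  let T := G.support.filter fun a => a.degree = 1
  have hT (a) (ha : a ∈ T) : coeff a G ∈ I₂ := by
    have h1 := (hG a).2.2.1
    rw [(Finset.mem_filter.1 ha).2] at h1
    exact ⟨(hG a).2.1, h1⟩
  let c (a : Fin n →₀ ℕ) (j : Fin (Module.finrank k I₂)) : k :=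
    if h : coeff a G ∈ I₂ then e.repr ⟨coeff a G, h⟩ j else 0
  have hc (a) (ha : a ∈ T) : ∑ j, c a j • (e j : MvPolynomial (Fin n) k) = coeff a G := by
    have h := congrArg Subtype.val (e.sum_repr ⟨coeff a G, hT a ha⟩)
    simp only [Submodule.coe_sum, Submodule.coe_smul] at h
    simpa only [c, dif_pos (hT a ha)] using h
  let l (j : Fin (Module.finrank k I₂)) : MvPolynomial (Fin n) k := ∑ a ∈ T, monomial a (c a j)
  have hl (j) : l j ∈ homogeneousSubmodule (Fin n) k 1 :=
    Submodule.sum_mem _ fun a ha => isHomogeneous_monomial _ (Finset.mem_filter.1 ha).2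
  have : FiniteDimensional k (Submodule.span k (Set.range l)) :=
    FiniteDimensional.span_of_finite k (Set.finite_range l)
  let V := W ⊔ Submodule.span k (Set.range l)
  have hWV : Algebra.adjoin k (W : Set (MvPolynomial (Fin n) k)) ≤
      Algebra.adjoin k (V : Set (MvPolynomial (Fin n) k)) :=
    Algebra.adjoin_mono (SetLike.coe_subset_coe.2 le_sup_left)
  refine ⟨V, sup_le hW1 (Submodule.span_le.2 (Set.range_subset_iff.2 hl)), ?_, ?_⟩
  · refine (Submodule.finrank_add_le_finrank_add_finrank _ _).trans ?_
    exact Nat.add_le_add_left (by simpa [Set.finrank] using finrank_range_le_card (R := k) l) _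
  · have hlin_part : ∑ a ∈ T, coeff a G * monomial a 1 = ∑ j, l j * (e j : MvPolynomial _ k) := by
      simp only [l, Finset.sum_mul]
      rw [Finset.sum_comm]
      refine Finset.sum_congr rfl fun a ha => ?_
      rw [← hc a ha, Finset.sum_mul]
      refine Finset.sum_congr rfl fun j _ => ?_
      rw [smul_mul_assoc, mul_comm, ← smul_mul_assoc, smul_monomial, smul_eq_mul, mul_one]
    have hmon (a : Fin n →₀ ℕ) :
        ∏ i ∈ a.support, (X i : MvPolynomial (Fin n) k) ^ a i = monomial a 1 := by
      rw [monomial_eq, C_1, one_mul, Finsupp.prod]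
    rw [← hGf, eval_eq]
    simp only [hmon]
    rw [← Finset.sum_filter_add_sum_filter_not _ fun a => a.degree = 1, hlin_part]
    refine add_mem (sum_mem fun j _ => mul_mem ?_ ?_) (sum_mem fun a ha => ?_)
    · exact Algebra.subset_adjoin
        ((le_sup_right : _ ≤ V) (Submodule.subset_span (Set.mem_range_self j)))
    · exact hWV (IsHomogeneous.mem_adjoin_of_mem_iInf_span hlin hint (e j).2.2 (e j).2.1)
    · obtain ⟨ha, ha1⟩ := Finset.mem_filter.1 ha
      obtain rfl : a = 0 := by
        rw [← Finsupp.degree_eq_zero_iff]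
        have := hdeg a ha
        omega
      simpa using hWV (hG 0).1
end

section
/- Let k be a field, S = k[x_1,...,x_n], and let f ∈ S be a homogeneous polynomial. If V is a subspace of the space of linear forms such that f lies in the k-subalgebra S(V) generated by V, then every subspace P of linear forms with dim P = rk(f) and f ∈ (P) satisfies P ⊆ V; consequently L_f ⊆ V, and if f depends on at most m variables then dim L_f ≤ m. -/
open MvPolynomial

/-- The slice rank of a polynomial: minimal `r` such that `f` lies in an ideal
generated by `r` linear forms. -/
noncomputable def sliceRank {k : Type*} [Field k] {σ : Type*} (f : MvPolynomial σ k) : ℕ :=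
  sInf {r : ℕ | ∃ ℓ : Fin r → MvPolynomial σ k,
    (∀ i, (ℓ i).IsHomogeneous 1) ∧ f ∈ Ideal.span (Set.range ℓ)}

/-- `P_f`: the set of subspaces of linear forms of dimension `rk f` whose ideal contains `f`. -/
def slicePlanes {k : Type*} [Field k] {σ : Type*} (f : MvPolynomial σ k) :
    Set (Submodule k (MvPolynomial σ k)) :=
  {P | P ≤ homogeneousSubmodule σ k 1 ∧ Module.finrank k P = sliceRank f ∧
    f ∈ Ideal.span (P : Set (MvPolynomial σ k))}

/-- `L_f`: the sum of all subspaces in `P_f`. -/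
noncomputable def Lspace {k : Type*} [Field k] {σ : Type*} (f : MvPolynomial σ k) :
    Submodule k (MvPolynomial σ k) :=
  sSup (slicePlanes f)

/-- A space of linear forms in finitely many variables is finite dimensional. -/
theorem finiteDimensional_of_le_homogeneousSubmodule_one {k : Type*} [Field k] {σ : Type*}
    [Finite σ] {Q : Submodule k (MvPolynomial σ k)} (hQ : Q ≤ homogeneousSubmodule σ k 1) :
    FiniteDimensional k Q :=
  have : FiniteDimensional k (homogeneousSubmodule σ k 1) :=
    Module.Finite.iff_fg.mpr (homogeneousSubmodule_fg σ k 1)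
  Submodule.finiteDimensional_of_le hQ

/-- A subspace of linear forms whose ideal contains `f` has dimension at least `sliceRank f`. -/
theorem sliceRank_le_finrank {k : Type*} [Field k] {σ : Type*} {f : MvPolynomial σ k}
    {Q : Submodule k (MvPolynomial σ k)} [FiniteDimensional k Q]
    (hQ : Q ≤ homogeneousSubmodule σ k 1)
    (hf : f ∈ Ideal.span (Q : Set (MvPolynomial σ k))) :
    sliceRank f ≤ Module.finrank k Q := by
  let b := Module.finBasis k Q
  refine Nat.sInf_le ⟨fun i => b i, fun i => hQ (b i).2, ?_⟩
  refine Ideal.span_le.mpr (fun q hq => ?_) hf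
  have hsum := congrArg Subtype.val (b.sum_repr ⟨q, hq⟩)
  simp only [Submodule.coe_sum, Submodule.coe_smul] at hsum
  rw [← hsum]
  exact sum_mem fun i _ => Submodule.smul_of_tower_mem _ _ (Ideal.subset_span ⟨i, rfl⟩)

/-- On linear forms, the substitution `X i ↦ X i - g (X i) • p` is `l ↦ l - g l • p`. -/
theorem aeval_X_sub_smul_of_isHomogeneous_one {k : Type*} [Field k] {σ : Type*}
    (g : MvPolynomial σ k →ₗ[k] k) (p : MvPolynomial σ k) {l : MvPolynomial σ k}
    (hl : l.IsHomogeneous 1) :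
    aeval (fun i => X i - g (X i) • p) l = l - g l • p := by
  have hspan : l ∈ Submodule.span k (Set.range (X : σ → MvPolynomial σ k)) := by
    rw [← homogeneousSubmodule_one_eq_span_X]
    exact hl
  have hEq : Set.EqOn
      (aeval (R := k) fun i => X i - g (X i) • p : MvPolynomial σ k →ₐ[k] _).toLinearMap
      (LinearMap.id - g.smulRight p : MvPolynomial σ k →ₗ[k] _) (Set.range (X : σ → MvPolynomial σ k)) := by
    rintro _ ⟨i, rfl⟩
    simp
  simpa using LinearMap.eqOn_span hEq hspan

/-- If `f` lies in the subalgebra generated by a space `V` of linear forms, then any space of linear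
forms of minimal dimension whose ideal contains `f` is contained in `V`. -/
theorem le_of_mem_slicePlanes {k : Type*} [Field k] {σ : Type*} [Finite σ]
    {f : MvPolynomial σ k} {V P : Submodule k (MvPolynomial σ k)}
    (hV : V ≤ homogeneousSubmodule σ k 1)
    (hfV : f ∈ Algebra.adjoin k (V : Set (MvPolynomial σ k))) (hP : P ∈ slicePlanes f) :
    P ≤ V := by
  obtain ⟨hP1, hrank, hfP⟩ := hP
  have := finiteDimensional_of_le_homogeneousSubmodule_one hP1
  intro p hp
  by_contra hpV
  obtain ⟨g, hgV, hgp⟩ := LinearMap.exists_extend_of_notMem (0 : V →ₗ[k] k) hpV 1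
  let φ : MvPolynomial σ k →ₐ[k] MvPolynomial σ k := aeval fun i => X i - g (X i) • p
  have hφ {l : MvPolynomial σ k} (hl : l ∈ homogeneousSubmodule σ k 1) : φ l = l - g l • p :=
    aeval_X_sub_smul_of_isHomogeneous_one g p hl
  have hφf : φ f = f := by
    have hEq : Set.EqOn φ (AlgHom.id k (MvPolynomial σ k)) (V : Set (MvPolynomial σ k)) := by
      intro v hv
      have hgv : g v = 0 := LinearMap.congr_fun hgV ⟨v, hv⟩
      simp [hφ (hV hv), hgv]
    exact AlgHom.eqOn_adjoin_iff.mpr hEq hfV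
  have hφp : φ p = 0 := by simp [hφ (hP1 hp), hgp]
  let T : P →ₗ[k] MvPolynomial σ k := φ.toLinearMap ∘ₗ P.subtype
  have hT1 : LinearMap.range T ≤ homogeneousSubmodule σ k 1 := by
    rintro _ ⟨q, rfl⟩
    change φ q ∈ _
    rw [hφ (hP1 q.2)]
    exact sub_mem (hP1 q.2) (Submodule.smul_mem _ _ (hP1 hp))
  have hfT : f ∈ Ideal.span (LinearMap.range T : Set (MvPolynomial σ k)) := by
    have h := Ideal.mem_map_of_mem φ hfP
    rw [hφf, Ideal.map_span] at h
    refine Ideal.span_mono ?_ h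
    rintro _ ⟨q, hq, rfl⟩
    exact ⟨⟨q, hq⟩, rfl⟩
  have hker : LinearMap.ker T ≠ ⊥ := by
    intro h
    have hp0 : (⟨p, hp⟩ : P) = 0 := LinearMap.ker_eq_bot'.mp h _ hφp
    have hp0' : p = 0 := congrArg Subtype.val hp0
    exact hpV (hp0' ▸ V.zero_mem)
  have hpos : 0 < Module.finrank k (LinearMap.ker T) :=
    Nat.pos_of_ne_zero fun h => hker (Submodule.finrank_eq_zero.mp h)
  have hle := sliceRank_le_finrank hT1 hfT
  have hadd := LinearMap.finrank_range_add_finrank_ker T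
  omega

/-- If a homogeneous polynomial `f` lies in the subalgebra generated by a
subspace `V` of linear forms, then every `P ∈ P_f` satisfies `P ⊆ V`; consequently
`L_f ⊆ V`, and if `f` depends on at most `m` variables then `dim L_f ≤ m`. -/
theorem slicePlanes_le_of_mem_adjoin
    {k : Type*} [Field k] {n : ℕ} (d : ℕ)
    (f : MvPolynomial (Fin n) k) (hf : f.IsHomogeneous d)
    (V : Submodule k (MvPolynomial (Fin n) k))
    (hV : V ≤ homogeneousSubmodule (Fin n) k 1)
    (hfV : f ∈ Algebra.adjoin k (V : Set (MvPolynomial (Fin n) k))) :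
    (∀ P ∈ slicePlanes f, P ≤ V) ∧ Lspace f ≤ V ∧
      Module.finrank k (Lspace f) ≤ Module.finrank k V := by
  have hle : ∀ P ∈ slicePlanes f, P ≤ V := fun P hP => le_of_mem_slicePlanes hV hfV hP
  have := finiteDimensional_of_le_homogeneousSubmodule_one hV
  exact ⟨hle, sSup_le hle, Submodule.finrank_mono (sSup_le hle)⟩
end

section
/- Let k be a field, n ≥ 2, and consider the homogeneous cubic f_n = Σ_{1 ≤ i < j ≤ n} x_i x_j y_{ij} in the polynomial ring k[x_i, y_{jk} : 1 ≤ i ≤ n, 1 ≤ j < k ≤ n] in n + n(n−1)/2 variables. Then the slice rank of f_n equals n − 1. -/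
open MvPolynomial

/-- The variables `x_1, …, x_n` together with `y_{ij}` for `1 ≤ i < j ≤ n`. -/
abbrev TestVars (n : ℕ) := Fin n ⊕ {p : Fin n × Fin n // p.1 < p.2}

/-- The cubic `f_n = Σ_{i<j} x_i x_j y_{ij}`. -/
noncomputable def testCubic (k : Type*) [Field k] (n : ℕ) : MvPolynomial (TestVars n) k :=
  ∑ p : {p : Fin n × Fin n // p.1 < p.2},
    X (Sum.inl p.1.1) * X (Sum.inl p.1.2) * X (Sum.inr p)

/-- Among the products `x i * x j` with `i < j` of elements of a domain, the linearly independent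
ones are at least as many as among the `x i`, minus one. -/
theorem finrank_span_range_le_finrank_span_mul_add_one {k R : Type*} [Field k] [CommRing R]
    [IsDomain R] [Algebra k R] {n : ℕ} (x : Fin n → R) :
    Module.finrank k (Submodule.span k (Set.range x)) ≤
      Module.finrank k (Submodule.span k
        (Set.range fun p : {p : Fin n × Fin n // p.1 < p.2} => x p.1.1 * x p.1.2)) + 1 := by
  by_cases hx : ∀ i, x i = 0
  · have : x = 0 := funext hx
    subst this
    have h : Submodule.span k (Set.range (0 : Fin n → R)) = ⊥ := by
      rw [Submodule.span_eq_bot]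
      rintro _ ⟨i, rfl⟩
      rfl
    rw [h, finrank_bot]
    exact Nat.zero_le _
  push Not at hx
  obtain ⟨i, hi⟩ := hx
  let S : Submodule k R := Submodule.span k (x '' {i}ᶜ)
  have hS : FiniteDimensional k S :=
    FiniteDimensional.span_of_finite k (Set.toFinite _)
  have hle : Submodule.span k (Set.range x) ≤ Submodule.span k {x i} ⊔ S := by
    rw [Submodule.span_le]
    rintro _ ⟨j, rfl⟩
    by_cases hj : j = i
    · subst hj
      exact Submodule.mem_sup_left (Submodule.mem_span_singleton_self _)
    · exact Submodule.mem_sup_right (Submodule.subset_span ⟨j, hj, rfl⟩)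
  have hmul : S.map (LinearMap.mulLeft k (x i)) ≤ Submodule.span k
      (Set.range fun p : {p : Fin n × Fin n // p.1 < p.2} => x p.1.1 * x p.1.2) := by
    rw [Submodule.map_span, Submodule.span_le]
    rintro _ ⟨_, ⟨j, hj, rfl⟩, rfl⟩
    apply Submodule.subset_span
    rcases lt_or_gt_of_ne (show j ≠ i from hj) with h | h
    · exact ⟨⟨(j, i), h⟩, mul_comm _ _⟩
    · exact ⟨⟨(i, j), h⟩, rfl⟩
  have hfin : FiniteDimensional k (Submodule.span k
      (Set.range fun p : {p : Fin n × Fin n // p.1 < p.2} => x p.1.1 * x p.1.2)) :=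
    FiniteDimensional.span_of_finite k (Set.finite_range _)
  have hinj : Function.Injective (LinearMap.mulLeft k (x i)) := mul_right_injective₀ hi
  have h1 := Submodule.finrank_mono hle
  have h2 := Submodule.finrank_add_le_finrank_add_finrank (Submodule.span k {x i}) S
  have h3 := finrank_span_singleton (K := k) hi
  have h4 := Submodule.finrank_mono hmul
  have h5 := (Submodule.equivMapOfInjective _ hinj S).finrank_eq
  omega

/-- The span of the linear forms whose coefficients are the coordinates of the basis vectors `b j`
has the dimension of the span of the `b j`. -/
theorem finrank_span_linearForms {k ι κ : Type*} [Field k] [Fintype ι] [Fintype κ]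
    (b : κ → ι → k) :
    Module.finrank k (Submodule.span k (Set.range fun i =>
      ∑ j, b j i • (X j : MvPolynomial κ k))) =
      Module.finrank k (Submodule.span k (Set.range b)) := by
  have hinj : Function.Injective (Fintype.linearCombination k (X : κ → MvPolynomial κ k)) :=
    LinearIndependent.fintypeLinearCombination_injective (linearIndependent_X κ k)
  have h : (Set.range fun i => ∑ j, b j i • (X j : MvPolynomial κ k)) =
      Fintype.linearCombination k (X : κ → MvPolynomial κ k) ''
        Set.range (Matrix.of b).transpose.row := by
    rw [← Set.range_comp]
    rfl
  rw [h, ← Submodule.map_span, ← (Submodule.equivMapOfInjective _ hinj _).finrank_eq,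
    ← Matrix.rank_eq_finrank_span_row, Matrix.rank_transpose, Matrix.rank_eq_finrank_span_row]
  rfl

theorem aeval_testCubic {k R : Type*} [Field k] [CommRing R] [Algebra k R] {n : ℕ}
    (v : TestVars n → R) :
    aeval v (testCubic k n) = ∑ p : {p : Fin n × Fin n // p.1 < p.2},
      v (Sum.inl p.1.1) * v (Sum.inl p.1.2) * v (Sum.inr p) := by
  simp [testCubic]

theorem aeval_eq_zero_of_mem_span {k σ R ι : Type*} [Field k] [CommRing R] [Algebra k R]
    {f : MvPolynomial σ k} {ℓ : ι → MvPolynomial σ k} (hf : f ∈ Ideal.span (Set.range ℓ))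
    {v : σ → R} (hv : ∀ i, aeval v (ℓ i) = 0) : aeval v f = 0 := by
  have h : Ideal.span (Set.range ℓ) ≤ RingHom.ker (aeval v : MvPolynomial σ k →ₐ[k] R) := by
    rw [Ideal.span_le]
    rintro _ ⟨i, rfl⟩
    exact hv i
  exact h hf

theorem exists_eq_sum_smul_X {k σ : Type*} [Field k] [Fintype σ] {ℓ : MvPolynomial σ k}
    (h : ℓ.IsHomogeneous 1) : ∃ c : σ → k, ∑ s, c s • X s = ℓ := by
  rw [← mem_homogeneousSubmodule, homogeneousSubmodule_one_eq_span_X] at h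
  exact (Submodule.mem_span_range_iff_exists_fun k).1 h

theorem le_add_one_of_testCubic_mem_span {k : Type*} [Field k] {n r : ℕ}
    {ℓ : Fin r → MvPolynomial (TestVars n) k} (hℓ : ∀ i, (ℓ i).IsHomogeneous 1)
    (hf : testCubic k n ∈ Ideal.span (Set.range ℓ)) : n ≤ r + 1 := by
  choose c hc using fun i => exists_eq_sum_smul_X (hℓ i)
  let L := (Matrix.of c).mulVecLin
  let W := LinearMap.ker L
  let b := Module.finBasis k W
  let v : TestVars n → MvPolynomial (Fin (Module.finrank k W)) k :=
    fun s => ∑ j, (b j : TestVars n → k) s • X j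
  have hW : ∀ w ∈ W, ∀ i, ∑ s, c i s * w s = 0 := fun w hw i => congrFun hw i
  have hv : ∀ i, ∑ s, c i s • v s = 0 := by
    intro i
    simp only [v, Finset.smul_sum, smul_smul]
    rw [Finset.sum_comm]
    simp only [← Finset.sum_smul]
    simp [hW _ (b _).2 i]
  have haeval : ∀ w ∈ W, aeval (fun s => v s + C (w s)) (testCubic k n) = 0 := by
    intro w hw
    refine aeval_eq_zero_of_mem_span hf fun i => ?_
    rw [← hc i]
    simp only [map_sum, map_smul, aeval_X, smul_add, Finset.sum_add_distrib, hv, zero_add]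
    simp only [smul_eq_C_mul, ← C_mul, ← map_sum, hW w hw i, map_zero]
  let x : Fin n → MvPolynomial (Fin (Module.finrank k W)) k := fun i => v (Sum.inl i)
  let M := Fintype.linearCombination k
    (fun p : {p : Fin n × Fin n // p.1 < p.2} => x p.1.1 * x p.1.2)
  let px : W →ₗ[k] (Fin n → k) := LinearMap.funLeft k k Sum.inl ∘ₗ W.subtype
  let py : W →ₗ[k] ({p : Fin n × Fin n // p.1 < p.2} → k) :=
    LinearMap.funLeft k k Sum.inr ∘ₗ W.subtype
  have hpy : ∀ w, (py ∘ₗ (LinearMap.ker px).subtype) w ∈ LinearMap.ker M := by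
    rintro ⟨w, hw⟩
    have hw0 : ∀ i, (w : TestVars n → k) (Sum.inl i) = 0 := fun i => congrFun hw i
    have h0 := haeval 0 W.zero_mem
    have h1 := haeval w w.2
    rw [aeval_testCubic] at h0 h1
    simp only [hw0, Pi.zero_apply, map_zero, add_zero, mul_add, Finset.sum_add_distrib] at h0 h1
    rw [h0, zero_add] at h1
    rw [LinearMap.mem_ker, ← h1]
    refine Finset.sum_congr rfl fun p _ => ?_
    rw [smul_eq_C_mul, mul_comm]
    rfl
  have hinj : Function.Injective
      ((py ∘ₗ (LinearMap.ker px).subtype).codRestrict (LinearMap.ker M) hpy) := by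
    rintro ⟨w, hw⟩ ⟨w', hw'⟩ h
    ext s
    rcases s with i | p
    · exact congrFun (hw.trans hw'.symm) i
    · exact congrFun (congrArg Subtype.val h) p
  have hrange : LinearMap.range px =
      Submodule.span k (Set.range fun j i => (b j : TestVars n → k) (Sum.inl i)) := by
    rw [LinearMap.range_eq_map, ← b.span_eq, Submodule.map_span, ← Set.range_comp]
    rfl
  have h1 := LinearMap.finrank_le_finrank_of_injective hinj
  have h2 := LinearMap.finrank_range_add_finrank_ker M
  have h3 := LinearMap.finrank_range_add_finrank_ker px
  have h4 := LinearMap.finrank_range_add_finrank_ker L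
  have h5 := (LinearMap.range L).finrank_le
  have h6 := finrank_span_range_le_finrank_span_mul_add_one (k := k) x
  have h7 : Module.finrank k (Submodule.span k (Set.range x)) = _ :=
    finrank_span_linearForms fun j i => (b j : TestVars n → k) (Sum.inl i)
  rw [← hrange] at h7
  have hM : LinearMap.range M = _ := Fintype.range_linearCombination k _
  rw [← hM] at h6
  simp only [Module.finrank_fintype_fun_eq_card, Fintype.card_sum, Fintype.card_fin] at h2 h4 h5
  change _ + Module.finrank k W = _ at h4
  omega

theorem testCubic_mem_span (k : Type*) [Field k] (n : ℕ) :
    testCubic k n ∈ Ideal.span (Set.range fun i : Fin (n - 1) =>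
      (X (Sum.inl (i.castLE (Nat.sub_le n 1))) : MvPolynomial (TestVars n) k)) := by
  refine Ideal.sum_mem _ fun p _ => ?_
  rw [mul_assoc]
  refine Ideal.mul_mem_right _ _ (Ideal.subset_span ?_)
  have hlt : p.1.1.val < p.1.2.val := p.2
  exact ⟨⟨p.1.1, by omega⟩, rfl⟩

/-- For `n ≥ 2`, the cubic `f_n = Σ_{i<j} x_i x_j y_{ij}` has slice rank
`n − 1`. -/
theorem sliceRank_testCubic {k : Type*} [Field k] (n : ℕ) (hn : 2 ≤ n) :
    sliceRank (testCubic k n) = n - 1 := by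
  have hmem : n - 1 ∈ {r : ℕ | ∃ ℓ : Fin r → MvPolynomial (TestVars n) k,
      (∀ i, (ℓ i).IsHomogeneous 1) ∧ testCubic k n ∈ Ideal.span (Set.range ℓ)} :=
    ⟨_, fun _ => isHomogeneous_X _ _, testCubic_mem_span k n⟩
  refine le_antisymm (Nat.sInf_le hmem) (le_csInf ⟨_, hmem⟩ ?_)
  rintro r ⟨ℓ, hℓ, hf⟩
  exact Nat.sub_le_of_le_add (le_add_one_of_testCubic_mem_span hℓ hf)
end

section
/- Let k be a field. For every r ≥ 1 there exists n and a homogeneous cubic f ∈ k[x_1,...,x_n] of slice rank r with dim L_f ≥ r(r+1)/2 + r (i.e., the binomial coefficient C(r+1,2) plus r). In particular, the maximal possible value c(r) of dim L_f over cubics of slice rank r satisfies c(r) ≥ C(r+1,2) + r. -/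
open MvPolynomial

section Monomials

variable {ι : Type*}

/-- The degree-two monomial `x i * x j` attached to the unordered pair `s(i, j)`. -/
def pairMul {M : Type*} [CommMagma M] (x : ι → M) (z : Sym2 ι) : M := (z.map x).mul

@[simp] lemma pairMul_mk {M : Type*} [CommMagma M] (x : ι → M) (i j : ι) :
    pairMul x s(i, j) = x i * x j := rfl

lemma map_pairMul {A B F : Type*} [CommSemiring A] [CommSemiring B] [FunLike F A B]
    [RingHomClass F A B] (φ : F) (x : ι → A) (z : Sym2 ι) :
    φ (pairMul x z) = pairMul (fun i => φ (x i)) z := by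
  induction z with
  | _ i j => simp

lemma pairMul_mul {A : Type*} [CommSemiring A] (x y : ι → A) (z : Sym2 ι) :
    pairMul (fun i => x i * y i) z = pairMul x z * pairMul y z := by
  induction z with
  | _ i j => simp [mul_mul_mul_comm]

lemma pairMul_single_one {A : Type*} [CommSemiring A] [DecidableEq ι] (i : ι) (z : Sym2 ι) :
    pairMul (Pi.single i (1 : A) : ι → A) z = if z = s(i, i) then 1 else 0 := by
  induction z with
  | _ p q =>
    simp only [pairMul_mk, Pi.single_apply, Sym2.eq_iff, ite_mul, one_mul, zero_mul, or_self]
    grind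

lemma pairMul_single_add_single {A : Type*} [CommSemiring A] [DecidableEq ι] {i j : ι}
    (hij : i ≠ j) (z : Sym2 ι) :
    pairMul (Pi.single i 1 + Pi.single j 1 : ι → A) z =
      pairMul (Pi.single i 1 : ι → A) z + pairMul (Pi.single j 1 : ι → A) z + if z = s(i, j) then 1 else 0 := by
  induction z with
  | _ p q =>
    simp only [pairMul_mk, Pi.add_apply, Pi.single_apply, Sym2.eq_iff]
    split_ifs <;> grind

end Monomials

section LinearAlgebra

variable {k ι : Type*} [Field k] [Fintype ι] [DecidableEq ι]

lemma exists_sum_pairMul_mul_eq_sq (φ : (ι → k) →ₗ[k] k) :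
    ∃ y : Sym2 ι → k, ∀ x : ι → k, ∑ z, pairMul x z * y z = φ x ^ 2 := by
  refine ⟨fun z => ∑ p : ι × ι with Sym2.mk p.1 p.2 = z,
    φ (Pi.single p.1 1) * φ (Pi.single p.2 1), fun x => ?_⟩
  have hx : φ x = ∑ i, x i * φ (Pi.single i 1) := by
    conv_lhs => rw [pi_eq_sum_univ' x]
    simp [map_sum]
  have key : ∀ z : Sym2 ι, pairMul x z * ∑ p : ι × ι with Sym2.mk p.1 p.2 = z,
      φ (Pi.single p.1 1) * φ (Pi.single p.2 1) = ∑ p : ι × ι with Sym2.mk p.1 p.2 = z,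
      (x p.1 * φ (Pi.single p.1 1)) * (x p.2 * φ (Pi.single p.2 1)) := by
    intro z
    rw [Finset.mul_sum]
    refine Finset.sum_congr rfl fun p hp => ?_
    rw [← (Finset.mem_filter.mp hp).2, pairMul_mk]
    ring
  simp only [key]
  rw [Finset.sum_fiberwise, hx, sq, Fintype.sum_mul_sum, Fintype.sum_prod_type]

/-- A linear subspace on which `∑ z, x^z * y_z` vanishes has dimension at most the number of
coordinates `y_z`. -/
lemma finrank_le_of_sum_pairMul_mul_eq_zero (W : Submodule k ((ι → k) × (Sym2 ι → k)))
    (hW : ∀ w ∈ W, ∑ z, pairMul w.1 z * w.2 z = 0) :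
    Module.finrank k W ≤ Fintype.card (Sym2 ι) := by
  set A : Submodule k (ι → k) := W.map (LinearMap.fst k _ _) with hA
  obtain ⟨p, hp⟩ := A.subtype.exists_leftInverse_of_injective A.ker_subtype
  have hp' : ∀ v : A, p v = v := fun v => LinearMap.congr_fun hp v
  let b := Module.finBasis k A
  let φ := fun m => b.coord m ∘ₗ p
  let T : (Sym2 ι → k) →ₗ[k] (Fin (Module.finrank k A) → k) :=
    LinearMap.pi fun m => ∑ z, pairMul (b m : ι → k) z • LinearMap.proj z
  have hT : ∀ y m, T y m = ∑ z, pairMul (b m : ι → k) z * y z := by simp [T]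
  have hsurj : Function.Surjective T := by
    intro c
    choose Y hY using fun m => exists_sum_pairMul_mul_eq_sq (φ m)
    refine ⟨∑ m, c m • Y m, funext fun m => ?_⟩
    have hYm : ∀ m', T (Y m') m = if m = m' then 1 else 0 := by
      intro m'
      rw [hT, hY]
      simp [φ, hp', Finsupp.single_apply]
    simp [map_sum, hYm]
  obtain ⟨S, hS⟩ := T.exists_rightInverse_of_surjective (LinearMap.range_eq_top.mpr hsurj)
  have hS' : ∀ c, T (S c) = c := fun c => LinearMap.congr_fun hS c
  let g : W →ₗ[k] (Sym2 ι → k) :=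
    (LinearMap.snd k _ _ + S ∘ₗ (LinearMap.pi φ ∘ₗ LinearMap.fst k _ _ - T ∘ₗ LinearMap.snd k _ _))
      ∘ₗ W.subtype
  have hinj : Function.Injective g := by
    rw [injective_iff_map_eq_zero]
    rintro ⟨⟨x, y⟩, hw⟩ h0
    have hg : y + S (LinearMap.pi φ x - T y) = 0 := h0
    have hφ : LinearMap.pi φ x = 0 := by
      have := congrArg T hg
      simpa [hS'] using this
    have hxA : x ∈ A := ⟨(x, y), hw, rfl⟩
    have hx : x = 0 := by
      have h1 : b.repr ⟨x, hxA⟩ = 0 := by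
        ext m
        have := congrFun hφ m
        simpa [φ, hp' ⟨x, hxA⟩] using this
      simpa using h1
    subst hx
    have hTy : T y = 0 := by
      funext m
      obtain ⟨⟨v, y'⟩, hv, hvm⟩ := (b m).2
      have hvm : v = b m := hvm
      have h1 := hW _ (W.add_mem hv hw)
      have h2 := hW _ hv
      simp only [Prod.mk_add_mk, add_zero, Pi.add_apply, mul_add, Finset.sum_add_distrib] at h1 h2
      rw [h2, zero_add] at h1
      rw [hT, ← hvm, h1, Pi.zero_apply]
    rw [hφ, hTy] at hg
    simpa using hg
  simpa using LinearMap.finrank_le_finrank_of_injective hinj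

end LinearAlgebra

section SliceRank

variable {k σ : Type*} [Field k]

lemma exists_linearMap_eq_eval {p : MvPolynomial σ k} (hp : p.IsHomogeneous 1) :
    ∃ φ : (σ → k) →ₗ[k] k, ∀ v, φ v = eval v p := by
  have hp' : p ∈ homogeneousSubmodule σ k 1 := hp
  rw [homogeneousSubmodule_one_eq_span_X] at hp'
  induction hp' using Submodule.span_induction with
  | mem x h =>
    obtain ⟨i, rfl⟩ := h
    exact ⟨LinearMap.proj i, by simp⟩
  | zero => exact ⟨0, by simp⟩
  | add x y hx hy ihx ihy =>
    rw [← homogeneousSubmodule_one_eq_span_X] at hx hy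
    obtain ⟨φ, hφ⟩ := ihx hx
    obtain ⟨ψ, hψ⟩ := ihy hy
    exact ⟨φ + ψ, by simp [hφ, hψ]⟩
  | smul a x hx ih =>
    rw [← homogeneousSubmodule_one_eq_span_X] at hx
    obtain ⟨φ, hφ⟩ := ih hx
    exact ⟨a • φ, by simp [hφ]⟩

lemma exists_submodule_eval_eq_zero [Fintype σ] {f : MvPolynomial σ k} {s : ℕ}
    {ℓ : Fin s → MvPolynomial σ k} (hℓ : ∀ i, (ℓ i).IsHomogeneous 1)
    (hf : f ∈ Ideal.span (Set.range ℓ)) :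
    ∃ W : Submodule k (σ → k), (∀ v ∈ W, eval v f = 0) ∧
      Fintype.card σ ≤ Module.finrank k W + s := by
  choose φ hφ using fun i => exists_linearMap_eq_eval (hℓ i)
  refine ⟨(LinearMap.pi φ).ker, fun v hv => ?_, ?_⟩
  · have hle : Ideal.span (Set.range ℓ) ≤ RingHom.ker (eval v) := by
      rw [Ideal.span_le]
      rintro _ ⟨i, rfl⟩
      have := congrFun (LinearMap.mem_ker.mp hv) i
      simpa [hφ] using this
    exact hle hf
  · have h1 := (LinearMap.pi φ).finrank_range_add_finrank_ker
    have h2 := (LinearMap.pi φ).range.finrank_le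
    simp only [Module.finrank_fintype_fun_eq_card, Fintype.card_fin] at h1 h2
    omega

lemma sliceRank_le {f : MvPolynomial σ k} {s : ℕ} {ℓ : Fin s → MvPolynomial σ k}
    (hℓ : ∀ i, (ℓ i).IsHomogeneous 1) (hf : f ∈ Ideal.span (Set.range ℓ)) : sliceRank f ≤ s :=
  Nat.sInf_le ⟨ℓ, hℓ, hf⟩

lemma mem_Lspace {f : MvPolynomial σ k} {ℓ : Fin (sliceRank f) → MvPolynomial σ k}
    (hℓ : ∀ i, (ℓ i).IsHomogeneous 1) (hf : f ∈ Ideal.span (Set.range ℓ))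
    (i : Fin (sliceRank f)) : ℓ i ∈ Lspace f := by
  have hspan : Submodule.span k (Set.range ℓ) ∈ slicePlanes f := by
    have hP : Submodule.span k (Set.range ℓ) ≤ homogeneousSubmodule σ k 1 := by
      rw [Submodule.span_le]
      rintro _ ⟨i, rfl⟩
      exact hℓ i
    refine ⟨hP, le_antisymm ?_ ?_, Ideal.span_mono Submodule.subset_span hf⟩
    · exact (finrank_range_le_card (R := k) ℓ).trans_eq (Fintype.card_fin _)
    · have := FiniteDimensional.span_of_finite k (Set.finite_range ℓ)
      let b := Module.finBasis k (Submodule.span k (Set.range ℓ))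
      refine sliceRank_le (ℓ := fun j => (b j : MvPolynomial σ k)) (fun j => hP (b j).2) ?_
      refine Ideal.span_le.mpr ?_ hf
      rintro _ ⟨i, rfl⟩
      have hmem : ℓ i ∈ Submodule.span k (Set.range ℓ) := Submodule.subset_span ⟨i, rfl⟩
      have hsum := congrArg Subtype.val (b.sum_repr ⟨ℓ i, hmem⟩)
      rw [← show _ = ℓ i from hsum, Submodule.coe_sum]
      refine Ideal.sum_mem _ fun j _ => ?_
      rw [Submodule.coe_smul, smul_eq_C_mul]
      exact Ideal.mul_mem_left _ _ (Ideal.subset_span ⟨j, rfl⟩)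
  exact le_sSup hspan (Submodule.subset_span ⟨i, rfl⟩)

lemma Lspace_le (f : MvPolynomial σ k) : Lspace f ≤ homogeneousSubmodule σ k 1 :=
  sSup_le fun _ hP => hP.1

end SliceRank

section PairCubic

variable {k ι σ : Type*} [Field k] [Fintype ι]

/-- The cubic `∑ x_i x_j y_{ij}` over unordered pairs, the variables `x_i` and `y_{ij}` being
named by `e`. -/
noncomputable def pairCubic (k : Type*) [Field k] (e : ι ⊕ Sym2 ι ≃ σ) : MvPolynomial σ k :=
  ∑ z, pairMul (fun i => X (e (.inl i))) z * X (e (.inr z))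

/-- The linear form `∑ a_i a_j y_{ij}` over unordered pairs. -/
noncomputable def pairForm (e : ι ⊕ Sym2 ι ≃ σ) (a : ι → k) : MvPolynomial σ k :=
  ∑ z, C (pairMul a z) * X (e (.inr z))

variable (e : ι ⊕ Sym2 ι ≃ σ)

lemma isHomogeneous_pairCubic : (pairCubic k e).IsHomogeneous 3 := by
  refine IsHomogeneous.sum _ _ _ fun z _ => ?_
  induction z with
  | _ i j => exact ((isHomogeneous_X _ _).mul (isHomogeneous_X _ _)).mul (isHomogeneous_X _ _)

lemma isHomogeneous_pairForm (a : ι → k) : (pairForm e a).IsHomogeneous 1 :=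
  IsHomogeneous.sum _ _ _ fun _ _ => isHomogeneous_C_mul_X _ _

lemma card_le_of_pairCubic_mem_span [DecidableEq ι] {s : ℕ} {ℓ : Fin s → MvPolynomial σ k}
    (hℓ : ∀ i, (ℓ i).IsHomogeneous 1) (hf : pairCubic k e ∈ Ideal.span (Set.range ℓ)) :
    Fintype.card ι ≤ s := by
  have : Fintype σ := Fintype.ofEquiv _ e
  obtain ⟨W, hW, hdim⟩ := exists_submodule_eval_eq_zero hℓ hf
  let E : (σ → k) ≃ₗ[k] (ι → k) × (Sym2 ι → k) :=
    (LinearEquiv.funCongrLeft k k e).trans (LinearEquiv.sumArrowLequivProdArrow ι (Sym2 ι) k k)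
  have h := finrank_le_of_sum_pairMul_mul_eq_zero
    (W.map (E : (σ → k) →ₗ[k] (ι → k) × (Sym2 ι → k))) (by
      rintro _ ⟨v, hv, rfl⟩
      have h0 := hW v hv
      simp only [pairCubic, map_sum, map_mul, map_pairMul, eval_X] at h0
      exact h0)
  rw [LinearEquiv.finrank_map_eq] at h
  have hc := Fintype.card_congr e
  rw [Fintype.card_sum] at hc
  omega

lemma pairCubic_mem_span_X :
    pairCubic k e ∈ Ideal.span (Set.range fun i => (X (e (.inl i)) : MvPolynomial σ k)) := by
  refine Ideal.sum_mem _ fun z _ => ?_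
  induction z with
  | _ i j =>
    rw [pairMul_mk, mul_assoc]
    exact Ideal.mul_mem_right _ _ (Ideal.subset_span ⟨i, rfl⟩)

/-- The equations of the line `x = t • a` (normalised by `a i = 1`), with the one indexed by `i`
replaced by `pairForm e a`, generate an ideal containing the cubic. -/
lemma pairCubic_mem_span_update [DecidableEq ι] {a : ι → k} {i : ι} (ha : a i = 1) :
    pairCubic k e ∈ Ideal.span (Set.range (Function.update
      (fun l => X (e (.inl l)) - C (a l) * X (e (.inl i))) i (pairForm e a))) := by
  set ℓ := Function.update
    (fun l => X (e (.inl l)) - C (a l) * X (e (.inl i))) i (pairForm e a)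
  set π := Ideal.Quotient.mk (Ideal.span (Set.range ℓ))
  have h0 : ∀ l, π (ℓ l) = 0 := fun l =>
    Ideal.Quotient.eq_zero_iff_mem.mpr (Ideal.subset_span ⟨l, rfl⟩)
  obtain ⟨t, hx⟩ : ∃ t, ∀ l, π (X (e (.inl l))) = π (C (a l)) * t := by
    refine ⟨π (X (e (.inl i))), fun l => ?_⟩
    by_cases hl : l = i
    · simp [hl, ha]
    · have hl' : ℓ l = X (e (.inl l)) - C (a l) * X (e (.inl i)) := Function.update_of_ne hl _ _
      rw [← map_mul, ← sub_eq_zero, ← map_sub, ← hl', h0 l]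
  have hQ : ∑ z, pairMul (fun l => π (C (a l))) z * π (X (e (.inr z))) = 0 := by
    have hi : ℓ i = pairForm e a := Function.update_self _ _ _
    rw [← h0 i, hi, pairForm, map_sum]
    simp only [map_mul, map_pairMul]
  have hconst : ∀ z : Sym2 ι, pairMul (fun _ => t) z = t * t := by
    intro z
    induction z with
    | _ p q => rfl
  rw [← Ideal.Quotient.eq_zero_iff_mem]
  change π _ = 0
  simp only [pairCubic, map_sum, map_mul, map_pairMul, hx, pairMul_mul, hconst]
  rw [← mul_zero (t * t), ← hQ, Finset.mul_sum]
  exact Finset.sum_congr rfl fun z _ => by ring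

lemma pairForm_single [DecidableEq ι] (i : ι) :
    pairForm e (Pi.single i (1 : k)) = X (e (.inr s(i, i))) := by
  simp [pairForm, pairMul_single_one, apply_ite C]

lemma pairForm_single_add_single [DecidableEq ι] {i j : ι} (hij : i ≠ j) :
    pairForm e (Pi.single i (1 : k) + Pi.single j 1) =
      pairForm e (Pi.single i (1 : k)) + pairForm e (Pi.single j (1 : k)) + X (e (.inr s(i, j))) := by
  simp [pairForm, pairMul_single_add_single hij, add_mul, Finset.sum_add_distrib, apply_ite C]

end PairCubic

section FinCubic

variable {k σ : Type*} [Field k] {r : ℕ} (e : Fin r ⊕ Sym2 (Fin r) ≃ σ)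

lemma sliceRank_pairCubic : sliceRank (pairCubic k e) = r := by
  refine le_antisymm (sliceRank_le (fun i => isHomogeneous_X _ _) (pairCubic_mem_span_X e)) ?_
  refine le_csInf ⟨r, _, fun i => isHomogeneous_X _ _, pairCubic_mem_span_X e⟩ ?_
  rintro s ⟨ℓ, hℓ, hf⟩
  simpa using card_le_of_pairCubic_mem_span e hℓ hf

lemma mem_Lspace_pairCubic {ℓ : Fin r → MvPolynomial σ k} (hℓ : ∀ i, (ℓ i).IsHomogeneous 1)
    (hf : pairCubic k e ∈ Ideal.span (Set.range ℓ)) (i : Fin r) :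
    ℓ i ∈ Lspace (pairCubic k e) := by
  have key : ∀ s, s = sliceRank (pairCubic k e) → ∀ ℓ : Fin s → MvPolynomial σ k,
      (∀ i, (ℓ i).IsHomogeneous 1) → pairCubic k e ∈ Ideal.span (Set.range ℓ) →
      ∀ i, ℓ i ∈ Lspace (pairCubic k e) := by
    rintro s rfl ℓ hℓ hf i
    exact mem_Lspace hℓ hf i
  exact key r (sliceRank_pairCubic e).symm ℓ hℓ hf i

lemma pairForm_mem_Lspace {a : Fin r → k} {i : Fin r} (ha : a i = 1) :
    pairForm e a ∈ Lspace (pairCubic k e) := by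
  have h := mem_Lspace_pairCubic e (fun l => ?_) (pairCubic_mem_span_update e ha) i
  · rwa [Function.update_self] at h
  · by_cases hl : l = i
    · rw [hl, Function.update_self]
      exact isHomogeneous_pairForm e a
    · rw [Function.update_of_ne hl]
      exact (isHomogeneous_X _ _).sub (isHomogeneous_C_mul_X _ _)

lemma Lspace_pairCubic : Lspace (pairCubic k e) = homogeneousSubmodule σ k 1 := by
  refine le_antisymm (Lspace_le _) ?_
  rw [homogeneousSubmodule_one_eq_span_X, Submodule.span_le]
  rintro _ ⟨v, rfl⟩
  obtain ⟨u, rfl⟩ := e.surjective v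
  have hs : ∀ i, pairForm e (Pi.single i (1 : k)) ∈ Lspace (pairCubic k e) := fun i =>
    pairForm_mem_Lspace e (Pi.single_eq_same i 1)
  rcases u with i | z
  · exact mem_Lspace_pairCubic e (fun i => isHomogeneous_X _ _) (pairCubic_mem_span_X e) i
  · induction z with
    | _ i j =>
      by_cases hij : i = j
      · subst hij
        exact pairForm_single (k := k) e i ▸ hs i
      · have h : pairForm e (Pi.single i (1 : k) + Pi.single j 1) ∈ Lspace (pairCubic k e) :=
          pairForm_mem_Lspace e (i := i) (by simp [hij])
        rw [pairForm_single_add_single e hij] at h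
        exact (Submodule.add_mem_iff_right _ (add_mem (hs i) (hs j))).mp h

end FinCubic

/-- For every `r ≥ 1` there is a homogeneous cubic `f` in some polynomial
ring `k[x_1,…,x_n]` of slice rank `r` with `dim L_f ≥ C(r+1, 2) + r`; in particular
`c(r) ≥ C(r+1, 2) + r`. -/
theorem exists_cubic_with_large_Lspace
    {k : Type*} [Field k] (r : ℕ) (hr : 1 ≤ r) :
    ∃ (n : ℕ) (f : MvPolynomial (Fin n) k), f.IsHomogeneous 3 ∧ sliceRank f = r ∧
      Nat.choose (r + 1) 2 + r ≤ Module.finrank k (Lspace f) := by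
  let e := Fintype.equivFin (Fin r ⊕ Sym2 (Fin r))
  refine ⟨_, pairCubic k e, isHomogeneous_pairCubic e, sliceRank_pairCubic e, ?_⟩
  rw [Lspace_pairCubic, homogeneousSubmodule_one_eq_span_X,
    finrank_span_eq_card (linearIndependent_X _ _), Fintype.card_fin, Fintype.card_sum,
    Sym2.card, Fintype.card_fin, add_comm]
end

section
/- Let V be a vector space over a field k and let (P_i)_{i∈I} be a nonempty collection of 3-dimensional subspaces of V such that dim(P_i ∩ P_j) = 2 for all i ≠ j. Then either dim( ∩_{i∈I} P_i ) ≥ 2, or dim( Σ_{i∈I} P_i ) ≤ 4. -/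
/-- Among 3-dimensional subspaces meeting pairwise in dimension 2, one that does not contain
`A ⊓ B` lies in `A ⊔ B`. -/
theorem Submodule.le_sup_of_not_inf_le
    {k : Type*} [Field k] {V : Type*} [AddCommGroup V] [Module k V] {A B C : Submodule k V}
    (hC : Module.finrank k C = 3) (hAB : Module.finrank k ↥(A ⊓ B) = 2)
    (hCA : Module.finrank k ↥(C ⊓ A) = 2) (hCB : Module.finrank k ↥(C ⊓ B) = 2)
    (h : ¬ A ⊓ B ≤ C) : C ≤ A ⊔ B := by
  have : FiniteDimensional k C := Module.finite_of_finrank_pos (by omega)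
  have : FiniteDimensional k ↥(A ⊓ B) := Module.finite_of_finrank_pos (by omega)
  have hnle : ¬ C ⊓ B ≤ C ⊓ A := fun hle => by
    have heq : C ⊓ B = A ⊓ B :=
      Submodule.eq_of_le_of_finrank_eq (le_inf (hle.trans inf_le_right) inf_le_right)
        (hCB.trans hAB.symm)
    exact h (heq ▸ inf_le_left)
  have hsup : C ⊓ A ⊔ C ⊓ B ≤ C := sup_le inf_le_left inf_le_left
  have : FiniteDimensional k ↥(C ⊓ A ⊔ C ⊓ B) := Submodule.finiteDimensional_of_le hsup
  have hlt := Submodule.finrank_lt_finrank_of_lt (left_lt_sup.mpr hnle)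
  have heq : C ⊓ A ⊔ C ⊓ B = C := Submodule.eq_of_le_of_finrank_le hsup (by omega)
  exact heq.ge.trans (sup_le_sup inf_le_right inf_le_right)


/-- Let `(P_i)_{i ∈ ι}` be a nonempty family of 3-dimensional subspaces of a
vector space `V` over a field `k` such that any two distinct members intersect in a
2-dimensional subspace. Then either `dim (∩ᵢ P_i) ≥ 2`, or `dim (Σᵢ P_i) ≤ 4`. -/
theorem common_intersection_or_small_sum
    {k : Type*} [Field k] {V : Type*} [AddCommGroup V] [Module k V]
    {ι : Type*} [Nonempty ι] (P : ι → Submodule k V)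
    (h3 : ∀ i, Module.finrank k (P i) = 3)
    (h2 : ∀ i j, i ≠ j → Module.finrank k ↥(P i ⊓ P j) = 2) :
    2 ≤ Module.finrank k ↥(⨅ i, P i) ∨ Module.finrank k ↥(⨆ i, P i) ≤ 4 := by
  have hfin (i) : FiniteDimensional k (P i) :=
    Module.finite_of_finrank_pos (by have := h3 i; omega)
  obtain ⟨i⟩ := ‹Nonempty ι›
  have : FiniteDimensional k ↥(⨅ i, P i) := Submodule.finiteDimensional_of_le (iInf_le P i)
  by_cases hj : ∃ j, i ≠ j
  swap
  · push Not at hj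
    left
    have hle : P i ≤ ⨅ j, P j := le_iInf fun j => by rw [hj j]
    have := Submodule.finrank_mono hle
    have := h3 i
    omega
  obtain ⟨j, hij⟩ := hj
  by_cases hl : ∀ l, P i ⊓ P j ≤ P l
  · left
    have hle : P i ⊓ P j ≤ ⨅ l, P l := le_iInf hl
    have := Submodule.finrank_mono hle
    have := h2 i j hij
    omega
  right
  push Not at hl
  obtain ⟨l, hl⟩ := hl
  have le_sup {a b m : ι} (hab : a ≠ b) (h : ¬ P a ⊓ P b ≤ P m) : P m ≤ P a ⊔ P b := by
    have hma : m ≠ a := by rintro rfl; exact h inf_le_left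
    have hmb : m ≠ b := by rintro rfl; exact h inf_le_right
    exact Submodule.le_sup_of_not_inf_le (h3 m) (h2 a b hab) (h2 m a hma) (h2 m b hmb) h
  have hil : i ≠ l := by rintro rfl; exact hl inf_le_left
  have hS : ⨆ m, P m ≤ P i ⊔ P j := by
    refine iSup_le fun m => ?_
    by_cases h₁ : P i ⊓ P j ≤ P m
    swap
    · exact le_sup hij h₁
    by_cases h₂ : P i ⊓ P l ≤ P m
    swap
    · exact (le_sup hil h₂).trans (sup_le le_sup_left (le_sup hij hl))
    by_cases hmi : m = i
    · exact hmi ▸ le_sup_left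
    have hm := h2 m i hmi
    have e₁ : P i ⊓ P j = P m ⊓ P i :=
      Submodule.eq_of_le_of_finrank_eq (le_inf h₁ inf_le_left) ((h2 i j hij).trans hm.symm)
    have e₂ : P i ⊓ P l = P m ⊓ P i :=
      Submodule.eq_of_le_of_finrank_eq (le_inf h₂ inf_le_left) ((h2 i l hil).trans hm.symm)
    exact absurd ((e₁.trans e₂.symm).le.trans inf_le_right) hl
  have := Submodule.finrank_mono hS
  have := Submodule.finrank_sup_add_finrank_inf_eq (P i) (P j)
  have := h3 i
  have := h3 j
  have := h2 i j hij
  omega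
end
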